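/- arXiv:2405.11763 — 2 statements merged into one kernel-verified Lean document; each statement's English description precedes it below -/
import Mathlib

section
/- For every complex number k = α + iβ with α ∈ ℝ and −√2 ≤ β ≤ 1, one has β − Re √(2 + k²) ≤ 0, where √ denotes the principal branch of the complex square root (the branch with nonnegative real part). -/
/-- For every complex number `k = α + iβ` with `−√2 ≤ β ≤ 1`, one has
`β − Re √(2 + k²) ≤ 0`, where `√` is the principal branch of the complex square root. -/
theorem stmt_0 (k : ℂ) (h1 : -Real.sqrt 2 ≤ k.im) (h2 : k.im ≤ 1) :
    k.im - ((2 + k ^ 2) ^ ((1 : ℂ) / 2)).re ≤ 0 := by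
  rw [one_div, Complex.cpow_inv_two_re, sub_nonpos]
  rcases le_total k.im 0 with h | h
  · exact h.trans (Real.sqrt_nonneg _)
  · have hre : (2 + k ^ 2).re = 2 + k.re ^ 2 - k.im ^ 2 := by
      simp [pow_two]
      ring
    apply Real.le_sqrt_of_sq_le
    nlinarith [Complex.re_le_norm (2 + k ^ 2), sq_nonneg k.re]
end

section
/- For p > 1, say that p is resonant if there exists a nonzero bounded pair of twice continuously differentiable functions u, v : ℝ → ℂ satisfying for all x ∈ ℝ the system −u''(x) + u(x) − ((p+1)/2)·φ_p(x)^{p−1}·u(x) − ((p−1)/2)·φ_p(x)^{p−1}·v(x) = u(x) and v''(x) − v(x) + ((p−1)/2)·φ_p(x)^{p−1}·u(x) + ((p+1)/2)·φ_p(x)^{p−1}·v(x) = v(x). Then the set of resonant exponents p has no accumulation point in (1, ∞); i.e., for every p₀ ∈ (1, ∞) there is ε > 0 such that no p with 0 < |p − p₀| < ε is resonant and, moreover, the set of resonant p is discrete in (1, ∞). -/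
/-- The ground state `φ_p` of the pure power NLS on the line. -/
noncomputable def groundState (p x : ℝ) : ℝ :=
  ((p + 1) / 2) ^ (1 / (p - 1)) * (1 / Real.cosh ((p - 1) * x / 2)) ^ (2 / (p - 1))

/-- `p` is resonant if the threshold equation `H u⃗ = u⃗` for the linearization of the
NLS at `φ_p` has a nonzero bounded `C²` solution. -/
def Resonant (p : ℝ) : Prop :=
  ∃ u v : ℝ → ℂ,
    ¬ (∀ x : ℝ, u x = 0 ∧ v x = 0) ∧
    (∃ M : ℝ, ∀ x : ℝ, ‖u x‖ ≤ M ∧ ‖v x‖ ≤ M) ∧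
    ContDiff ℝ 2 u ∧ ContDiff ℝ 2 v ∧
    (∀ x : ℝ,
      -(deriv (deriv u) x) + u x
        - ((((p + 1) / 2) * groundState p x ^ (p - 1) : ℝ) : ℂ) * u x
        - ((((p - 1) / 2) * groundState p x ^ (p - 1) : ℝ) : ℂ) * v x
        = u x ∧
      deriv (deriv v) x - v x
        + ((((p - 1) / 2) * groundState p x ^ (p - 1) : ℝ) : ℂ) * u x
        + ((((p + 1) / 2) * groundState p x ^ (p - 1) : ℝ) : ℂ) * v x
        = v x)

open Filter Topology

/-- One coefficient of the power series, in `1 - tanh y`, of the renormalized wedge product of the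
two bounded Jost solutions. -/
structure JostCoeff (K : Type*) where
  /-- the component `u ∧ v` -/
  α : K
  /-- the component `u ∧ (∂v + κ v)`, up to a factor -/
  b : K
  /-- the component `∂u ∧ v`, up to a factor -/
  c : K
  /-- the component `∂u ∧ (∂v + κ v)`, up to a factor -/
  e : K
  /-- the component `u ∧ ∂u`, up to a factor -/
  p : K

namespace JostCoeff

section Field
variable {K : Type*} [Field K]

/-- The recursion expressing the `n`-th coefficient through the previous two, `X` and `Y`. -/
def next (κ A n : K) (X Y : JostCoeff K) : JostCoeff K :=
  let e := ((n - 1) * X.e + A * (2 * (X.b + X.c) - (Y.b + Y.c)) - 2 * (2 * X.p - Y.p))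
    / (2 * n + 2 * κ)
  let b := ((n - 1) * X.b - e + (2 * X.α - Y.α)) / (2 * n + 2 * κ)
  let c := ((n - 1) * X.c - e + (2 * X.α - Y.α)) / (2 * n)
  { α := ((n - 1) * X.α - A * (b + c)) / (2 * n)
    b := b
    c := c
    e := e
    p := ((n - 1) * X.p + (2 * X.α - Y.α)) / (2 * n + κ) }

/-- The sequence of coefficients. -/
def seq (κ A : K) : ℕ → JostCoeff K
  | 0 => ⟨1 + κ, 0, 0, 0, 0⟩
  | 1 => ⟨-(A * (2 + κ)) / 2, 1, 1 + κ, 0, 2 * (1 + κ) / (2 + κ)⟩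
  | n + 2 => next κ A (n + 2) (seq κ A (n + 1)) (seq κ A n)

/-- Apply a map to every component. -/
def map {L : Type*} (f : K → L) (X : JostCoeff K) : JostCoeff L :=
  ⟨f X.α, f X.b, f X.c, f X.e, f X.p⟩

theorem seq_map {L : Type*} [Field L] (f : K →+* L) (κ A : K) (n : ℕ) :
    seq (f κ) (f A) n = map f (seq κ A n) := by
  have h2 : f 2 = 2 := map_ofNat f 2
  induction n using Nat.twoStepInduction with
  | zero => simp [seq, map]
  | one => simp [seq, map, h2]
  | more n h0 h1 =>
    simp only [seq, h0, h1]
    simp [next, map, h2]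

end Field

/-- All components are bounded by `B`. -/
def BoundedBy (X : JostCoeff ℂ) (B : ℝ) : Prop :=
  ‖X.α‖ ≤ B ∧ ‖X.b‖ ≤ B ∧ ‖X.c‖ ≤ B ∧ ‖X.e‖ ≤ B ∧ ‖X.p‖ ≤ B

theorem BoundedBy.mono {X : JostCoeff ℂ} {B B' : ℝ} (h : X.BoundedBy B) (hB : B ≤ B') :
    X.BoundedBy B' :=
  ⟨h.1.trans hB, h.2.1.trans hB, h.2.2.1.trans hB, h.2.2.2.1.trans hB, h.2.2.2.2.trans hB⟩

theorem norm_div_le_of_le {x y : ℂ} {d T : ℝ} (hd : 0 < d) (hy : d ≤ ‖y‖)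
    (hx : ‖x‖ ≤ d * T) : ‖x / y‖ ≤ T := by
  have hT : 0 ≤ T := by
    by_contra! h
    nlinarith [norm_nonneg x]
  rw [norm_div, div_le_iff₀ (hd.trans_le hy)]
  nlinarith

theorem next_boundedBy {κ A : ℂ} {n : ℕ} (hn : 1 ≤ n) {X Y : JostCoeff ℂ} {Q B₁ B₂ d T : ℝ}
    (hT0 : 0 ≤ T) (hX : X.BoundedBy B₁) (hY : Y.BoundedBy B₂) (hA : ‖A‖ ≤ Q) (hd : 0 < d)
    (d1 : d ≤ ‖(2 * n + 2 * κ : ℂ)‖) (d2 : d ≤ ‖(2 * n + κ : ℂ)‖) (d3 : d ≤ ‖(2 * n : ℂ)‖)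
    (hT : (n - 1) * B₁ + (Q + 1) * (4 * B₁ + 2 * B₂) + (1 + 2 * Q) * T ≤ d * T) :
    (next κ A n X Y).BoundedBy T := by
  obtain ⟨xα, xb, xc, xe, xp⟩ := hX
  obtain ⟨yα, yb, yc, ye, yp⟩ := hY
  have hn' : (0 : ℝ) ≤ n - 1 := by
    rw [sub_nonneg]; exact_mod_cast hn
  have hnn : ‖(n - 1 : ℂ)‖ = n - 1 := by
    have := Complex.norm_real ((n : ℝ) - 1)
    rw [Real.norm_of_nonneg hn'] at this
    exact_mod_cast this
  have hB₁ : 0 ≤ B₁ := (norm_nonneg _).trans xα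
  have hB₂ : 0 ≤ B₂ := (norm_nonneg _).trans yα
  have hQ : 0 ≤ Q := (norm_nonneg _).trans hA
  have key (x : ℂ) (hx : ‖x‖ ≤ B₁) : ‖(n - 1 : ℂ) * x‖ ≤ (n - 1) * B₁ := by
    rw [norm_mul, hnn]; gcongr
  have two (x : ℂ) (B : ℝ) (hx : ‖x‖ ≤ B) : ‖2 * x‖ ≤ 2 * B := by
    rw [norm_mul]; simpa using hx
  have mulA (x : ℂ) (B : ℝ) (hx : ‖x‖ ≤ B) : ‖A * x‖ ≤ Q * B := by
    rw [norm_mul]; gcongr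
  have F : ‖2 * X.α - Y.α‖ ≤ 2 * B₁ + B₂ :=
    (norm_sub_le _ _).trans (add_le_add (two _ _ xα) yα)
  have P : ‖2 * (2 * X.p - Y.p)‖ ≤ 2 * (2 * B₁ + B₂) :=
    two _ _ ((norm_sub_le _ _).trans (add_le_add (two _ _ xp) yp))
  have G : ‖A * (2 * (X.b + X.c) - (Y.b + Y.c))‖ ≤ Q * (2 * (B₁ + B₁) + (B₂ + B₂)) :=
    mulA _ _ ((norm_sub_le _ _).trans (add_le_add
      (two _ _ ((norm_add_le _ _).trans (add_le_add xb xc)))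
      ((norm_add_le _ _).trans (add_le_add yb yc))))
  have hQT : 0 ≤ Q * T := by positivity
  have hQB₁ : 0 ≤ Q * B₁ := by positivity
  have hQB₂ : 0 ≤ Q * B₂ := by positivity
  have he : ‖(next κ A n X Y).e‖ ≤ T := by
    refine norm_div_le_of_le hd d1 ?_
    refine (norm_sub_le _ _).trans ((add_le_add (norm_add_le _ _) le_rfl).trans ?_)
    nlinarith [key _ xe]
  have hb : ‖(next κ A n X Y).b‖ ≤ T := by
    refine norm_div_le_of_le hd d1 ?_
    refine (norm_add_le _ _).trans ((add_le_add (norm_sub_le _ _) le_rfl).trans ?_)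
    change _ + ‖(next κ A n X Y).e‖ + _ ≤ _
    nlinarith [key _ xb]
  have hc : ‖(next κ A n X Y).c‖ ≤ T := by
    refine norm_div_le_of_le hd d3 ?_
    refine (norm_add_le _ _).trans ((add_le_add (norm_sub_le _ _) le_rfl).trans ?_)
    change _ + ‖(next κ A n X Y).e‖ + _ ≤ _
    nlinarith [key _ xc]
  refine ⟨?_, hb, hc, he, ?_⟩
  · refine norm_div_le_of_le hd d3 ?_
    refine (norm_sub_le _ _).trans ?_
    have := mulA _ _ ((norm_add_le _ _).trans (add_le_add hb hc))
    change _ + ‖A * ((next κ A n X Y).b + (next κ A n X Y).c)‖ ≤ _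
    nlinarith [key _ xα]
  · refine norm_div_le_of_le hd d2 ?_
    refine (norm_add_le _ _).trans ?_
    nlinarith [key _ xp]

/-- The half plane on which the coefficients are holomorphic. -/
def domain : Set ℂ := {κ | -(3 / 2) < κ.re}

theorem isOpen_domain : IsOpen domain := isOpen_lt continuous_const Complex.continuous_re

theorem isPreconnected_domain : IsPreconnected domain :=
  (convex_halfSpace_re_gt _).isPreconnected

theorem two_mul_add_ne_zero {κ : ℂ} (hκ : κ ∈ domain) (n : ℕ) :
    (2 * ((n : ℂ) + 2) + 2 * κ) ≠ 0 ∧ (2 * ((n : ℂ) + 2) + κ) ≠ 0 ∧ (2 * ((n : ℂ) + 2)) ≠ 0 := by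
  have hκ' : -(3 / 2) < κ.re := hκ
  have hn : (0 : ℝ) ≤ n := n.cast_nonneg
  refine ⟨fun h => ?_, fun h => ?_, fun h => ?_⟩ <;>
  · have := congrArg Complex.re h
    simp at this
    linarith

/-- The coupling constant along the curve of exponents. -/
noncomputable def coupling (κ : ℂ) : ℂ := (1 + κ / (√2 : ℝ)) ^ 2

theorem differentiableOn_seq (n : ℕ) :
    DifferentiableOn ℂ (fun κ => (seq κ (coupling κ) n).α) domain ∧
    DifferentiableOn ℂ (fun κ => (seq κ (coupling κ) n).b) domain ∧
    DifferentiableOn ℂ (fun κ => (seq κ (coupling κ) n).c) domain ∧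
    DifferentiableOn ℂ (fun κ => (seq κ (coupling κ) n).e) domain ∧
    DifferentiableOn ℂ (fun κ => (seq κ (coupling κ) n).p) domain := by
  have hA : DifferentiableOn ℂ coupling domain := by unfold coupling; fun_prop
  induction n using Nat.twoStepInduction with
  | zero => simp only [seq]; refine ⟨?_, ?_, ?_, ?_, ?_⟩ <;> fun_prop
  | one =>
    simp only [seq]
    refine ⟨?_, ?_, ?_, ?_, ?_⟩
    any_goals fun_prop
    refine DifferentiableOn.div (by fun_prop) (by fun_prop) fun κ hκ h => ?_
    have hκ' : -(3 / 2) < κ.re := hκ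
    have := congrArg Complex.re h
    simp at this
    linarith
  | more n h0 h1 =>
    obtain ⟨xα, xb, xc, xe, xp⟩ := h1
    obtain ⟨yα, yb, yc, ye, yp⟩ := h0
    have he : DifferentiableOn ℂ (fun κ => (seq κ (coupling κ) (n + 2)).e) domain :=
      DifferentiableOn.div (by fun_prop) (by fun_prop) fun κ hκ => (two_mul_add_ne_zero hκ n).1
    have hb : DifferentiableOn ℂ (fun κ => (seq κ (coupling κ) (n + 2)).b) domain :=
      DifferentiableOn.div ((DifferentiableOn.sub (by fun_prop) he).add (by fun_prop))
        (by fun_prop) fun κ hκ => (two_mul_add_ne_zero hκ n).1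
    have hc : DifferentiableOn ℂ (fun κ => (seq κ (coupling κ) (n + 2)).c) domain :=
      DifferentiableOn.div ((DifferentiableOn.sub (by fun_prop) he).add (by fun_prop))
        (by fun_prop) fun κ hκ => (two_mul_add_ne_zero hκ n).2.2
    refine ⟨?_, hb, hc, he, ?_⟩
    · exact DifferentiableOn.div (DifferentiableOn.sub (by fun_prop) (hA.mul (hb.add hc)))
        (by fun_prop) fun κ hκ => (two_mul_add_ne_zero hκ n).2.2
    · exact DifferentiableOn.div (by fun_prop) (by fun_prop)
        fun κ hκ => (two_mul_add_ne_zero hκ n).2.1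

theorem exists_boundedBy {K : Set ℂ} (hK : IsCompact K) (hKd : K ⊆ domain) (n : ℕ) :
    ∃ B, ∀ κ ∈ K, (seq κ (coupling κ) n).BoundedBy B := by
  obtain ⟨xα, xb, xc, xe, xp⟩ := differentiableOn_seq n
  obtain ⟨B1, h1⟩ := hK.exists_bound_of_continuousOn (xα.continuousOn.mono hKd)
  obtain ⟨B2, h2⟩ := hK.exists_bound_of_continuousOn (xb.continuousOn.mono hKd)
  obtain ⟨B3, h3⟩ := hK.exists_bound_of_continuousOn (xc.continuousOn.mono hKd)
  obtain ⟨B4, h4⟩ := hK.exists_bound_of_continuousOn (xe.continuousOn.mono hKd)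
  obtain ⟨B5, h5⟩ := hK.exists_bound_of_continuousOn (xp.continuousOn.mono hKd)
  refine ⟨max B1 (max B2 (max B3 (max B4 B5))), fun κ hκ => ⟨?_, ?_, ?_, ?_, ?_⟩⟩
  · exact (h1 κ hκ).trans (by simp)
  · exact (h2 κ hκ).trans (by simp)
  · exact (h3 κ hκ).trans (by simp)
  · exact (h4 κ hκ).trans (by simp)
  · exact (h5 κ hκ).trans (by simp)

theorem exists_boundedBy_geometric {K : Set ℂ} (hK : IsCompact K) (hKd : K ⊆ domain) :
    ∃ C, ∀ κ ∈ K, ∀ n, (seq κ (coupling κ) n).BoundedBy (C * (3 / 4) ^ n) := by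
  obtain ⟨R, hR⟩ := hK.exists_bound_of_continuousOn continuousOn_id
  obtain ⟨Q, hQ⟩ := hK.exists_bound_of_continuousOn (f := coupling)
    (by unfold coupling; fun_prop)
  choose B hB using exists_boundedBy hK hKd
  obtain ⟨N, hN⟩ := exists_nat_gt (3 * |R| + 20 * (|Q| + 1))
  obtain ⟨C, hC⟩ : ∃ C, ∀ n < N, B n ≤ C * (3 / 4) ^ n := by
    refine ⟨∑ n ∈ Finset.range N, |B n| / (3 / 4) ^ n, fun n hn => ?_⟩
    rw [← div_le_iff₀ (by positivity)]
    refine le_trans ?_ (Finset.single_le_sum (f := fun n => |B n| / (3 / 4 : ℝ) ^ n)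
      (fun _ _ => by positivity) (Finset.mem_range.2 hn))
    gcongr
    exact le_abs_self _
  refine ⟨C, fun κ hκ n => ?_⟩
  induction n using Nat.strong_induction_on with
  | _ n ih =>
    rcases lt_or_ge n N with hn | hn
    · exact (hB n κ hκ).mono (hC n hn)
    have hnN : (N : ℝ) ≤ n := by exact_mod_cast hn
    have hκR : ‖κ‖ ≤ |R| := (hR κ hκ).trans (le_abs_self _)
    have hAQ : ‖coupling κ‖ ≤ |Q| := (hQ κ hκ).trans (le_abs_self _)
    have hR0 := abs_nonneg R
    have hQ0 := abs_nonneg Q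
    obtain ⟨m, rfl⟩ : ∃ m, n = m + 2 := by
      refine ⟨n - 2, ?_⟩
      have : (2 : ℝ) ≤ n := by linarith
      have : 2 ≤ n := by exact_mod_cast this
      omega
    have i1 := ih (m + 1) (by omega)
    have i0 := ih m (by omega)
    have hC0 : 0 ≤ C * (3 / 4) ^ m := (norm_nonneg _).trans i0.1
    have cast : ((m + 2 : ℕ) : ℂ) = (m : ℂ) + 2 := by push_cast; ring
    have h2n : ‖(2 * (m + 2 : ℕ) : ℂ)‖ = 2 * (m + 2 : ℕ) := by
      rw [norm_mul, Complex.norm_natCast]; simp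
    have h2κ : ‖2 * κ‖ = 2 * ‖κ‖ := by rw [norm_mul]; simp
    have := next_boundedBy (κ := κ) (A := coupling κ) (n := m + 2)
      (d := 2 * (m + 2 : ℕ) - 2 * |R|) (T := C * (3 / 4) ^ (m + 2)) (by omega)
      (by rw [pow_succ, pow_succ]; nlinarith) i1 i0 hAQ
      (by linarith) ?_ ?_ ?_ ?_
    · rw [cast] at this
      exact this
    · have := norm_sub_le (2 * (m + 2 : ℕ) + 2 * κ) (2 * κ)
      rw [add_sub_cancel_right, h2n, h2κ] at this
      linarith
    · have := norm_sub_le (2 * (m + 2 : ℕ) + κ) κ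
      rw [add_sub_cancel_right, h2n] at this
      linarith
    · rw [h2n]; linarith
    · push_cast at hnN ⊢
      rw [show (3 / 4 : ℝ) ^ (m + 2) = (3 / 4) ^ m * (9 / 16) by ring,
        show (3 / 4 : ℝ) ^ (m + 1) = (3 / 4) ^ m * (3 / 4) by ring]
      have : (0 : ℝ) ≤ (2 * (m + 2) - 2 * |R|) * (9 / 16) - (m + 1) * (3 / 4)
          - (|Q| + 1) * 5 - (1 + 2 * |Q|) * (9 / 16) := by linarith
      nlinarith [mul_nonneg this hC0]

end JostCoeff

theorem Real.hasDerivAt_tanh' (y : ℝ) : HasDerivAt Real.tanh (1 - Real.tanh y ^ 2) y := by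
  have h := (Real.hasDerivAt_sinh y).div (Real.hasDerivAt_cosh y) (Real.cosh_pos y).ne'
  have e : Real.tanh = fun y => Real.sinh y / Real.cosh y := funext Real.tanh_eq_sinh_div_cosh
  have e' : 1 - Real.tanh y ^ 2
      = (Real.cosh y * Real.cosh y - Real.sinh y * Real.sinh y) / Real.cosh y ^ 2 := by
    have := (Real.cosh_pos y).ne'
    rw [Real.tanh_eq_sinh_div_cosh]
    field_simp
  rw [e', e]
  exact h

theorem Real.one_sub_tanh_mem (y : ℝ) : 0 ≤ 1 - Real.tanh y ∧ 1 - Real.tanh y ≤ 2 :=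
  ⟨by linarith [Real.tanh_lt_one y], by linarith [Real.neg_one_lt_tanh y]⟩

theorem Real.one_sub_tanh_sq_nonneg (y : ℝ) : 0 ≤ 1 - Real.tanh y ^ 2 := by
  nlinarith [Real.tanh_lt_one y, Real.neg_one_lt_tanh y]

theorem Real.tendsto_one_sub_tanh : Tendsto (fun y => 1 - Real.tanh y) atTop (𝓝 0) := by
  refine squeeze_zero (fun y => (Real.one_sub_tanh_mem y).1) (fun y => ?_)
    Real.tendsto_exp_neg_atTop_nhds_zero
  rw [Real.tanh_eq_sinh_div_cosh, ← Real.cosh_sub_sinh]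
  have h1 := Real.one_le_cosh y
  have h2 := Real.sinh_lt_cosh y
  have : 1 - Real.sinh y / Real.cosh y = (Real.cosh y - Real.sinh y) / Real.cosh y := by
    field_simp
  rw [this]
  exact div_le_self (by linarith) h1

theorem monotoneOn_Ici_of_hasDerivAt {f f' : ℝ → ℝ} {y₀ : ℝ}
    (hf : ∀ y ≥ y₀, HasDerivAt f (f' y) y) (hf' : ∀ y ≥ y₀, 0 ≤ f' y) :
    MonotoneOn f (Set.Ici y₀) := by
  refine monotoneOn_of_deriv_nonneg (convex_Ici _)
    (fun y hy => (hf y hy).continuousAt.continuousWithinAt)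
    (fun y hy => (hf y (interior_subset hy)).differentiableAt.differentiableWithinAt)
    fun y hy => ?_
  rw [(hf y (interior_subset hy)).deriv]
  exact hf' y (interior_subset hy)

theorem not_forall_le_of_le_deriv {g g' : ℝ → ℝ} {M δ y₀ : ℝ} (hδ : 0 < δ)
    (hg : ∀ y, HasDerivAt g (g' y) y) (hM : ∀ y, |g y| ≤ M) : ¬ ∀ y ≥ y₀, δ ≤ g' y := by
  intro h
  have mono : MonotoneOn (fun y => g y - δ * y) (Set.Ici y₀) :=
    monotoneOn_Ici_of_hasDerivAt (f' := fun y => g' y - δ * 1)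
      (fun y _ => (hg y).sub ((hasDerivAt_id' y).const_mul δ))
      fun y hy => by linarith [h y hy]
  have hM0 : 0 ≤ M := (abs_nonneg _).trans (hM 0)
  have hle : y₀ ≤ y₀ + (2 * M + 1) / δ := le_add_of_nonneg_right (by positivity)
  have := mono (Set.mem_Ici.2 le_rfl) (Set.mem_Ici.2 hle) hle
  simp only at this
  have e : δ * ((2 * M + 1) / δ) = 2 * M + 1 := by field_simp
  rw [mul_add, e] at this
  linarith [(abs_le.1 (hM y₀)).1, (abs_le.1 (hM (y₀ + (2 * M + 1) / δ))).2]

/-- A bounded function with integrably small second derivative has decaying derivative. -/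
theorem deriv_le_of_bounded {g g₁ g₂ : ℝ → ℝ} {M C : ℝ} (hg : ∀ y, HasDerivAt g (g₁ y) y)
    (hg₁ : ∀ y, HasDerivAt g₁ (g₂ y) y) (hM : ∀ y, |g y| ≤ M)
    (hg₂ : ∀ y, |g₂ y| ≤ C * (1 - Real.tanh y ^ 2)) (y : ℝ) :
    g₁ y ≤ C * (1 - Real.tanh y) := by
  have hC : 0 ≤ C := by simpa using (abs_nonneg _).trans (hg₂ 0)
  by_contra! hy
  refine not_forall_le_of_le_deriv (sub_pos.2 hy) hg hM (y₀ := y) fun x hx => ?_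
  have mono : MonotoneOn (fun y => g₁ y + C * Real.tanh y) (Set.Ici y) :=
    monotoneOn_Ici_of_hasDerivAt
      (fun y _ => (hg₁ y).add ((Real.hasDerivAt_tanh' y).const_mul C))
      fun y hy => by linarith [(abs_le.1 (hg₂ y)).1]
  have := mono (Set.mem_Ici.2 le_rfl) (Set.mem_Ici.2 hx) hx
  simp only at this
  nlinarith [Real.tanh_lt_one x]

/-- A bounded solution of `∂²v = κ² v + O(sech²)` has no component along the growing mode. -/
theorem growing_mode_le_of_bounded {κ : ℝ} (hκ : 0 < κ) {v v₁ F : ℝ → ℝ} {M C : ℝ}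
    (hv : ∀ y, HasDerivAt v (v₁ y) y)
    (hv₁ : ∀ y, HasDerivAt v₁ (κ ^ 2 * v y + F y) y) (hM : ∀ y, |v y| ≤ M)
    (hF : ∀ y, |F y| ≤ C * (1 - Real.tanh y ^ 2)) (y : ℝ) :
    v₁ y + κ * v y ≤ C * (1 - Real.tanh y) := by
  have hC : 0 ≤ C := by simpa using (abs_nonneg _).trans (hF 0)
  by_contra! hy
  set W : ℝ → ℝ := fun y => v₁ y + κ * v y - C * (1 - Real.tanh y) with hW
  have hWy : 0 < W y := sub_pos.2 hy
  have hW' (y : ℝ) : HasDerivAt W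
      (κ ^ 2 * v y + F y + κ * v₁ y - C * (0 - (1 - Real.tanh y ^ 2))) y :=
    ((hv₁ y).add ((hv y).const_mul κ)).sub
      (((hasDerivAt_const y (1 : ℝ)).sub (Real.hasDerivAt_tanh' y)).const_mul C)
  have he (y : ℝ) : HasDerivAt (fun y => Real.exp (-κ * y)) (Real.exp (-κ * y) * (-κ * 1)) y :=
    ((hasDerivAt_id' y).const_mul (-κ)).exp
  have mono : MonotoneOn (fun y => Real.exp (-κ * y) * W y) (Set.Ici y) := by
    refine monotoneOn_Ici_of_hasDerivAt (fun y _ => (he y).mul (hW' y)) fun x _ => ?_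
    have h1 : κ * W x ≤ κ ^ 2 * v x + F x + κ * v₁ x - C * (0 - (1 - Real.tanh x ^ 2)) := by
      have := (abs_le.1 (hF x)).1
      have h2 := mul_nonneg hκ.le (mul_nonneg hC (Real.one_sub_tanh_mem x).1)
      simp only [hW]
      nlinarith
    nlinarith [Real.exp_pos (-κ * x)]
  have grow (x : ℝ) (hx : y ≤ x) : Real.exp (κ * (x - y)) * W y ≤ W x := by
    have := mono (Set.mem_Ici.2 le_rfl) (Set.mem_Ici.2 hx) hx
    simp only at this
    have h3 := mul_le_mul_of_nonneg_left this (Real.exp_pos (κ * x)).le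
    rw [← mul_assoc, ← mul_assoc, ← Real.exp_add, ← Real.exp_add] at h3
    rw [show κ * x + -κ * x = 0 by ring, Real.exp_zero, one_mul] at h3
    rwa [show κ * (x - y) = κ * x + -κ * y by ring]
  have hM0 : 0 ≤ M := (abs_nonneg _).trans (hM 0)
  refine not_forall_le_of_le_deriv one_pos hv hM
    (y₀ := y + (κ * M + 1) / (κ * W y)) fun x hx => ?_
  have hpos : 0 ≤ (κ * M + 1) / (κ * W y) := by positivity
  have h4 := grow x (by linarith)
  have h5 : κ * M + 1 ≤ Real.exp (κ * (x - y)) * W y := by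
    have h6 : κ * (x - y) ≤ Real.exp (κ * (x - y)) := by
      linarith [Real.add_one_le_exp (κ * (x - y))]
    have h7 : (κ * M + 1) / (κ * W y) ≤ x - y := by linarith
    rw [div_le_iff₀ (by positivity)] at h7
    nlinarith
  have h8 := mul_nonneg hC (Real.one_sub_tanh_mem x).1
  have h9 : κ * v x ≤ κ * M := mul_le_mul_of_nonneg_left (abs_le.1 (hM x)).2 hκ.le
  simp only [hW] at h4 h5
  linarith

theorem exists_quadratic_bound {κ a : ℝ} (hκ : 0 < κ) : ∃ C : ℝ, 0 ≤ C ∧ ∀ x₁ x₂ x₃ x₄ : ℝ,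
    2 * x₂ / κ * (a ^ 2 * x₁ + a * ((x₃ - x₄) / (2 * κ)))
      + 2 * (x₃ + x₄) * (a * x₁ + a ^ 2 * ((x₃ - x₄) / (2 * κ)))
      ≤ C * (x₁ ^ 2 + x₂ ^ 2 + x₃ ^ 2 + x₄ ^ 2) := by
  refine ⟨|2 * a ^ 2 / κ| + |a / κ ^ 2| + |a / κ ^ 2| + |2 * a| + |2 * a| + |a ^ 2 / κ|
    + |a ^ 2 / κ|, by positivity, fun x₁ x₂ x₃ x₄ => ?_⟩
  have s₁ := sq_nonneg x₁
  have s₂ := sq_nonneg x₂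
  have s₃ := sq_nonneg x₃
  have s₄ := sq_nonneg x₄
  generalize hE : x₁ ^ 2 + x₂ ^ 2 + x₃ ^ 2 + x₄ ^ 2 = E
  have prod (c x z : ℝ) (hxz : x ^ 2 + z ^ 2 ≤ 2 * E) : c * (x * z) ≤ |c| * E := by
    refine (le_abs_self _).trans ?_
    rw [abs_mul]
    have : |x * z| ≤ E := by
      rw [abs_le]
      constructor <;> linarith [sq_nonneg (x + z), sq_nonneg (x - z), add_sq x z, sub_sq x z]
    gcongr
  have p1 := prod (2 * a ^ 2 / κ) x₂ x₁ (by linarith)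
  have p2 := prod (a / κ ^ 2) x₂ x₃ (by linarith)
  have p3 := prod (a / κ ^ 2) x₂ (-x₄) (by rw [neg_sq]; linarith)
  have p4 := prod (2 * a) x₃ x₁ (by linarith)
  have p5 := prod (2 * a) x₄ x₁ (by linarith)
  have p6 := prod (a ^ 2 / κ) x₃ x₃ (by linarith)
  have p7 := prod (a ^ 2 / κ) x₄ (-x₄) (by rw [neg_sq]; linarith)
  have e : 2 * x₂ / κ * (a ^ 2 * x₁ + a * ((x₃ - x₄) / (2 * κ)))
      + 2 * (x₃ + x₄) * (a * x₁ + a ^ 2 * ((x₃ - x₄) / (2 * κ)))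
      = 2 * a ^ 2 / κ * (x₂ * x₁) + a / κ ^ 2 * (x₂ * x₃) + a / κ ^ 2 * (x₂ * -x₄)
        + 2 * a * (x₃ * x₁) + 2 * a * (x₄ * x₁) + a ^ 2 / κ * (x₃ * x₃)
        + a ^ 2 / κ * (x₄ * -x₄) := by
    field_simp
    ring
  rw [e]
  linarith

/-- A solution of the threshold system which is `o(exp (-κ y))` vanishes. Here `hᵢ` are the
components of the solution multiplied by `exp (κ y)`. -/
theorem eq_zero_of_tendsto_zero {κ a : ℝ} (hκ : 0 < κ) {h₁ h₂ h₃ h₄ : ℝ → ℝ}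
    (d₁ : ∀ y ≥ 0, HasDerivAt h₁ (κ * h₁ y + h₂ y) y)
    (d₂ : ∀ y ≥ 0, HasDerivAt h₂
      (κ * h₂ y - (1 - Real.tanh y ^ 2) * (a ^ 2 * h₁ y + a * h₃ y)) y)
    (d₃ : ∀ y ≥ 0, HasDerivAt h₃ (κ * h₃ y + h₄ y) y)
    (d₄ : ∀ y ≥ 0, HasDerivAt h₄
      (κ * h₄ y + κ ^ 2 * h₃ y - (1 - Real.tanh y ^ 2) * (a * h₁ y + a ^ 2 * h₃ y)) y)
    (t₁ : Tendsto h₁ atTop (𝓝 0)) (t₂ : Tendsto h₂ atTop (𝓝 0)) (t₃ : Tendsto h₃ atTop (𝓝 0))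
    (t₄ : Tendsto h₄ atTop (𝓝 0)) : h₁ 0 = 0 ∧ h₂ 0 = 0 ∧ h₃ 0 = 0 ∧ h₄ 0 = 0 := by
  set E : ℝ → ℝ := fun y =>
    h₁ y ^ 2 + (h₂ y / κ) ^ 2 + (h₄ y + κ * h₃ y) ^ 2 + (h₄ y - κ * h₃ y) ^ 2 with hE
  obtain ⟨C, hC0, hC⟩ := exists_quadratic_bound (a := a) hκ
  have tE : Tendsto (fun y => E y * Real.exp C) atTop (𝓝 0) := by
    have := ((((t₁.pow 2).add ((t₂.div_const κ).pow 2)).add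
      ((t₄.add (t₃.const_mul κ)).pow 2)).add ((t₄.sub (t₃.const_mul κ)).pow 2)).mul_const
      (Real.exp C)
    simpa using this
  have bound (y : ℝ) :
      2 * (h₂ y / κ) / κ * (a ^ 2 * h₁ y + a * h₃ y)
        + 2 * ((h₄ y + κ * h₃ y) + (h₄ y - κ * h₃ y)) * (a * h₁ y + a ^ 2 * h₃ y)
        ≤ C * E y := by
    have := hC (h₁ y) (h₂ y / κ) (h₄ y + κ * h₃ y) (h₄ y - κ * h₃ y)
    rwa [show (h₄ y + κ * h₃ y - (h₄ y - κ * h₃ y)) / (2 * κ) = h₃ y by field_simp; ring] at this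
  have mono : MonotoneOn (fun y => E y * Real.exp (C * Real.tanh y)) (Set.Ici 0) := by
    have dE (y : ℝ) (hy : 0 ≤ y) := (((((d₁ y hy).pow 2).add (((d₂ y hy).div_const κ).pow 2)).add
      (((d₄ y hy).add ((d₃ y hy).const_mul κ)).pow 2)).add
      (((d₄ y hy).sub ((d₃ y hy).const_mul κ)).pow 2)).mul
      ((Real.hasDerivAt_tanh' y).const_mul C).exp
    refine monotoneOn_Ici_of_hasDerivAt dE fun y _ => ?_
    have b := mul_le_mul_of_nonneg_left (bound y) (Real.one_sub_tanh_sq_nonneg y)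
    have young : 0 ≤ 2 * κ * h₁ y ^ 2 + 2 * h₁ y * h₂ y + 2 / κ * h₂ y ^ 2 := by
      have : 2 * κ * h₁ y ^ 2 + 2 * h₁ y * h₂ y + 2 / κ * h₂ y ^ 2
          = (κ * (h₁ y + h₂ y / κ) ^ 2 + κ * h₁ y ^ 2 + κ * (h₂ y / κ) ^ 2) := by
        field_simp; ring
      rw [this]; positivity
    have sq : 0 ≤ 4 * κ * (h₄ y + κ * h₃ y) ^ 2 := by positivity
    have key : 0 ≤ 2 * κ * h₁ y ^ 2 + 2 * h₁ y * h₂ y + 2 / κ * h₂ y ^ 2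
        + 4 * κ * (h₄ y + κ * h₃ y) ^ 2 + (1 - Real.tanh y ^ 2) * (C * E y)
        - (1 - Real.tanh y ^ 2) * (2 * (h₂ y / κ) / κ * (a ^ 2 * h₁ y + a * h₃ y)
        + 2 * ((h₄ y + κ * h₃ y) + (h₄ y - κ * h₃ y)) * (a * h₁ y + a ^ 2 * h₃ y)) := by
      linarith
    refine (mul_nonneg (Real.exp_pos (C * Real.tanh y)).le key).trans_eq ?_
    simp only [hE, Pi.add_apply, Pi.sub_apply, Pi.pow_apply, Nat.cast_ofNat, Nat.reduceSub, pow_one]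
    field_simp
    ring
  have le (y : ℝ) (hy : 0 ≤ y) : E 0 ≤ E y * Real.exp C := by
    have := mono (Set.mem_Ici.2 le_rfl) (Set.mem_Ici.2 hy) hy
    simp only [Real.tanh_zero, mul_zero, Real.exp_zero, mul_one] at this
    refine this.trans ?_
    have : 0 ≤ E y := by positivity
    gcongr
    nlinarith [Real.tanh_lt_one y]
  have hE0 : E 0 ≤ 0 :=
    ge_of_tendsto tE ((eventually_ge_atTop 0).mono fun y hy => le y hy)
  have s₁ := sq_nonneg (h₁ 0)
  have s₂ := sq_nonneg (h₂ 0 / κ)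
  have s₃ := sq_nonneg (h₄ 0 + κ * h₃ 0)
  have s₄ := sq_nonneg (h₄ 0 - κ * h₃ 0)
  simp only [hE] at hE0
  have z₁ : h₁ 0 = 0 := pow_eq_zero_iff two_ne_zero |>.1 (by linarith)
  have z₂ : h₂ 0 / κ = 0 := pow_eq_zero_iff two_ne_zero |>.1 (by linarith)
  have z₃ : h₄ 0 + κ * h₃ 0 = 0 := pow_eq_zero_iff two_ne_zero |>.1 (by linarith)
  have z₄ : h₄ 0 - κ * h₃ 0 = 0 := pow_eq_zero_iff two_ne_zero |>.1 (by linarith)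
  refine ⟨z₁, (div_eq_zero_iff.1 z₂).resolve_right hκ.ne', ?_, by linarith⟩
  have : κ * h₃ 0 = 0 := by linarith
  exact (mul_eq_zero.1 this).resolve_left hκ.ne'

theorem Real.tanh_nonneg' {y : ℝ} (hy : 0 ≤ y) : 0 ≤ Real.tanh y := by
  rw [Real.tanh_eq_sinh_div_cosh]
  exact div_nonneg (Real.sinh_nonneg_iff.2 hy) (Real.cosh_pos y).le

namespace GeometricSeries

variable {a : ℕ → ℝ} {C : ℝ}

/-- The shifted sequence, with generating function multiplied by the variable. -/
def shift (a : ℕ → ℝ) : ℕ → ℝ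
  | 0 => 0
  | n + 1 => a n

/-- The Euler operator on coefficients. -/
def euler (a : ℕ → ℝ) (n : ℕ) : ℝ := n * a n

/-- The sum of the power series. -/
noncomputable def eval (a : ℕ → ℝ) (z : ℝ) : ℝ := ∑' n, a n * z ^ n

/-- The sum of the differentiated power series. -/
noncomputable def evalDeriv (a : ℕ → ℝ) (z : ℝ) : ℝ := ∑' n, a n * (n * z ^ (n - 1))

theorem abs_term_deriv_le (ha : ∀ n, |a n| ≤ C * (3 / 4) ^ n) {z : ℝ} (hz : |z| ≤ 7 / 6) (n : ℕ) :
    |a n * (n * z ^ (n - 1))| ≤ C * ((n : ℝ) ^ 1 * (7 / 8) ^ n) := by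
  have hC : 0 ≤ C := by simpa using (abs_nonneg _).trans (ha 0)
  rcases n with _ | n
  · simp
  rw [abs_mul, abs_mul, abs_pow, Nat.abs_cast, Nat.add_sub_cancel, pow_one]
  calc |a (n + 1)| * ((n + 1 : ℕ) * |z| ^ n)
      ≤ C * (3 / 4) ^ (n + 1) * ((n + 1 : ℕ) * (7 / 6) ^ n) := by
        gcongr
        exact ha _
    _ = C * ((n + 1 : ℕ) * (7 / 8) ^ n) * (3 / 4) := by
        rw [pow_succ, show (7 / 8 : ℝ) = 3 / 4 * (7 / 6) by norm_num, mul_pow]; ring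
    _ ≤ C * ((n + 1 : ℕ) * (7 / 8) ^ n) * (7 / 8) := by
        refine mul_le_mul_of_nonneg_left (by norm_num) (by positivity)
    _ = _ := by rw [pow_succ]; ring

theorem summable_bound_deriv : Summable fun n : ℕ => C * ((n : ℝ) ^ 1 * (7 / 8) ^ n) :=
  (summable_pow_mul_geometric_of_norm_lt_one 1 (by norm_num)).mul_left C

theorem hasSum_eval (ha : ∀ n, |a n| ≤ C * (3 / 4) ^ n) {z : ℝ} (hz : |z| ≤ 7 / 6) :
    HasSum (fun n => a n * z ^ n) (eval a z) := by
  refine Summable.hasSum (Summable.of_norm_bounded (g := fun n => C * (7 / 8) ^ n)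
    ((summable_geometric_of_lt_one (by norm_num) (by norm_num)).mul_left C) fun n => ?_)
  rw [Real.norm_eq_abs, abs_mul, abs_pow]
  have hC : 0 ≤ C := by simpa using (abs_nonneg _).trans (ha 0)
  calc |a n| * |z| ^ n ≤ C * (3 / 4) ^ n * (7 / 6) ^ n := by
        gcongr
        exact ha n
    _ = _ := by rw [show (7 / 8 : ℝ) = 3 / 4 * (7 / 6) by norm_num, mul_pow, mul_assoc]

theorem hasSum_evalDeriv (ha : ∀ n, |a n| ≤ C * (3 / 4) ^ n) {z : ℝ} (hz : |z| ≤ 7 / 6) :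
    HasSum (fun n => a n * (n * z ^ (n - 1))) (evalDeriv a z) :=
  (Summable.of_norm_bounded summable_bound_deriv (abs_term_deriv_le ha hz)).hasSum

theorem hasSum_euler (ha : ∀ n, |a n| ≤ C * (3 / 4) ^ n) {z : ℝ} (hz : |z| ≤ 7 / 6) :
    HasSum (fun n => euler a n * z ^ n) (z * evalDeriv a z) := by
  refine ((hasSum_evalDeriv ha hz).mul_left z).congr_fun fun n => ?_
  rcases n with _ | n
  · simp [euler]
  · rw [euler, Nat.add_sub_cancel, pow_succ]; ring

theorem hasSum_shift {s z : ℝ} (h : HasSum (fun n => a n * z ^ n) s) :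
    HasSum (fun n => shift a n * z ^ n) (z * s) := by
  rw [← hasSum_nat_add_iff' 1]
  simp only [Finset.sum_range_one, shift, zero_mul, sub_zero]
  refine (h.mul_left z).congr_fun fun n => ?_
  rw [pow_succ]; ring

theorem hasSum_of_eq {f g : ℕ → ℝ} {s t : ℝ} (h : HasSum f s) (hf : ∀ n, g n = f n)
    (hs : t = s) : HasSum g t := by
  rwa [hs, funext hf]

theorem hasDerivAt_eval (ha : ∀ n, |a n| ≤ C * (3 / 4) ^ n) {z : ℝ} (hz : |z| < 7 / 6) :
    HasDerivAt (eval a) (evalDeriv a z) z := by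
  have mem : z ∈ Metric.ball (0 : ℝ) (7 / 6) := by simpa using hz
  refine hasDerivAt_tsum_of_isPreconnected (u := fun n : ℕ => C * ((n : ℝ) ^ 1 * (7 / 8) ^ n))
    (g := fun n z => a n * z ^ n) (g' := fun n z => a n * (n * z ^ (n - 1)))
    summable_bound_deriv Metric.isOpen_ball (convex_ball _ _).isPreconnected
    (fun n y _ => (hasDerivAt_pow n y).const_mul _)
    (fun n y hy => abs_term_deriv_le ha (by simpa using (Metric.mem_ball.1 hy).le) n)
    mem (hasSum_eval ha hz.le).summable mem

theorem eval_zero (a : ℕ → ℝ) : eval a 0 = a 0 := by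
  rw [eval, tsum_eq_single 0 fun n hn => by simp [hn]]
  simp

end GeometricSeries

open GeometricSeries

namespace JostCoeff

theorem abs_le_of_seq {κ A : ℝ} {κ' : ℂ} (hκ : (κ : ℂ) = κ') (hA : (A : ℂ) = coupling κ') {C : ℝ}
    {n : ℕ} (h : (seq κ' (coupling κ') n).BoundedBy C) :
    |(seq κ A n).α| ≤ C ∧ |(seq κ A n).b| ≤ C ∧ |(seq κ A n).c| ≤ C ∧ |(seq κ A n).e| ≤ C ∧
      |(seq κ A n).p| ≤ C := by
  have := seq_map Complex.ofRealHom κ A n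
  simp only [Complex.ofRealHom_eq_coe, hκ, hA] at this
  rw [this] at h
  obtain ⟨h1, h2, h3, h4, h5⟩ := h
  simp only [map, Complex.ofRealHom_eq_coe, Complex.norm_real, Real.norm_eq_abs] at h1 h2 h3 h4 h5
  exact ⟨h1, h2, h3, h4, h5⟩

end JostCoeff

/-- The derivative along `y` of a power series in `1 - tanh y`, from a recursion. -/
theorem GeometricSeries.hasDerivAt_eval_one_sub_tanh {a r : ℕ → ℝ} {C : ℝ}
    (ha : ∀ n, |a n| ≤ C * (3 / 4) ^ n) {y : ℝ} (hy : 0 ≤ y) {d : ℝ}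
    (hr : HasSum (fun n => r n * (1 - Real.tanh y) ^ n) d)
    (hrec : ∀ n, 2 * euler a n - shift (euler a) n + r n = 0) :
    HasDerivAt (fun y => eval a (1 - Real.tanh y)) d y := by
  have hz : |1 - Real.tanh y| < 7 / 6 := by
    rw [abs_lt]
    constructor <;> linarith [Real.tanh_lt_one y, Real.tanh_nonneg' hy]
  refine ((hasDerivAt_eval ha hz).comp y ((Real.hasDerivAt_tanh' y).const_sub 1)).congr_deriv ?_
  have h := hasSum_euler ha hz.le
  have h0 := ((h.mul_left 2).sub (hasSum_shift h)).add hr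
  have e : ∀ n, 2 * (euler a n * (1 - Real.tanh y) ^ n)
      - shift (euler a) n * (1 - Real.tanh y) ^ n + r n * (1 - Real.tanh y) ^ n = 0 := fun n => by
    linear_combination (1 - Real.tanh y) ^ n * hrec n
  simp only [e] at h0
  linear_combination -(h0.unique hasSum_zero)

theorem GeometricSeries.tendsto_eval_one_sub_tanh {a : ℕ → ℝ} {C : ℝ}
    (ha : ∀ n, |a n| ≤ C * (3 / 4) ^ n) :
    Tendsto (fun y => eval a (1 - Real.tanh y)) atTop (𝓝 (a 0)) := by
  have := (hasDerivAt_eval ha (z := 0) (by norm_num)).continuousAt.tendsto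
  rw [eval_zero] at this
  exact this.comp Real.tendsto_one_sub_tanh

namespace JostCoeff

/-- The renormalized wedge product of the bounded Jost solutions, evaluated at `y`. -/
noncomputable def wedge (κ A y : ℝ) : JostCoeff ℝ where
  α := eval (fun n => (seq κ A n).α) (1 - Real.tanh y)
  b := eval (fun n => (seq κ A n).b) (1 - Real.tanh y)
  c := eval (fun n => (seq κ A n).c) (1 - Real.tanh y)
  e := eval (fun n => (seq κ A n).e) (1 - Real.tanh y)
  p := eval (fun n => (seq κ A n).p) (1 - Real.tanh y)

theorem hasDerivAt_wedge {κ A C : ℝ}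
    (hC : ∀ n, |(seq κ A n).α| ≤ C * (3 / 4) ^ n ∧ |(seq κ A n).b| ≤ C * (3 / 4) ^ n ∧
      |(seq κ A n).c| ≤ C * (3 / 4) ^ n ∧ |(seq κ A n).e| ≤ C * (3 / 4) ^ n ∧
        |(seq κ A n).p| ≤ C * (3 / 4) ^ n)
    (hκ : 0 < κ) {y : ℝ} (hy : 0 ≤ y) :
    HasDerivAt (fun y => (wedge κ A y).α) (A * ((wedge κ A y).b + (wedge κ A y).c)) y ∧
    HasDerivAt (fun y => (wedge κ A y).b)
      (2 * κ * (wedge κ A y).b + (wedge κ A y).e - (1 - Real.tanh y ^ 2) * (wedge κ A y).α) y ∧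
    HasDerivAt (fun y => (wedge κ A y).c)
      ((wedge κ A y).e - (1 - Real.tanh y ^ 2) * (wedge κ A y).α) y ∧
    HasDerivAt (fun y => (wedge κ A y).e)
      (2 * κ * (wedge κ A y).e
        - (1 - Real.tanh y ^ 2) * (A * ((wedge κ A y).b + (wedge κ A y).c))
        + 2 * (1 - Real.tanh y ^ 2) * (wedge κ A y).p) y ∧
    HasDerivAt (fun y => (wedge κ A y).p)
      (κ * (wedge κ A y).p - (1 - Real.tanh y ^ 2) * (wedge κ A y).α) y := by
  have hz : |1 - Real.tanh y| ≤ 7 / 6 := by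
    rw [abs_le]
    constructor <;> linarith [Real.tanh_lt_one y, Real.tanh_nonneg' hy]
  have sα := hasSum_eval (fun n => (hC n).1) hz
  have sb := hasSum_eval (fun n => (hC n).2.1) hz
  have sc := hasSum_eval (fun n => (hC n).2.2.1) hz
  have se := hasSum_eval (fun n => (hC n).2.2.2.1) hz
  have sp := hasSum_eval (fun n => (hC n).2.2.2.2) hz
  have sα1 := hasSum_shift sα
  have sα2 := hasSum_shift sα1
  have sb1 := hasSum_shift sb
  have sb2 := hasSum_shift sb1
  have sc1 := hasSum_shift sc
  have sc2 := hasSum_shift sc1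
  have sp1 := hasSum_shift sp
  have sp2 := hasSum_shift sp1
  have hn (n : ℕ) : 2 * ((n : ℝ) + 2) + 2 * κ ≠ 0 := by positivity
  have hn' (n : ℕ) : 2 * ((n : ℝ) + 2) + κ ≠ 0 := by positivity
  have hn'' (n : ℕ) : 2 * ((n : ℝ) + 2) ≠ 0 := by positivity
  refine ⟨?_, ?_, ?_, ?_, ?_⟩
  · refine hasDerivAt_eval_one_sub_tanh
      (r := fun n => A * ((seq κ A n).b + (seq κ A n).c)) (fun n => (hC n).1) hy
      (((sb.add sc).mul_left A).congr_fun fun n => by ring) fun n => ?_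
    rcases n with _ | _ | n
    · simp [euler, shift, seq]
    · simp [euler, shift, seq]; ring
    · simp only [euler, shift, seq, next]
      have := hn n
      have := hn'' n
      push_cast
      field_simp
      ring
  · refine hasDerivAt_eval_one_sub_tanh
      (r := fun n => 2 * κ * (seq κ A n).b + (seq κ A n).e - 2 * shift (fun n => (seq κ A n).α) n
        + shift (shift fun n => (seq κ A n).α) n) (fun n => (hC n).2.1) hy
      ?_ fun n => ?_
    · exact hasSum_of_eq ((((sb.mul_left (2 * κ)).add se).sub (sα1.mul_left 2)).add sα2)
        (fun n => by ring)
        (by simp only [wedge]; ring)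
    rcases n with _ | _ | n
    · simp [euler, shift, seq]
    · simp [euler, shift, seq]; ring
    · simp only [euler, shift, seq, next]
      have := hn n
      push_cast
      field_simp
      ring
  · refine hasDerivAt_eval_one_sub_tanh
      (r := fun n => (seq κ A n).e - 2 * shift (fun n => (seq κ A n).α) n
        + shift (shift fun n => (seq κ A n).α) n) (fun n => (hC n).2.2.1) hy
      ?_ fun n => ?_
    · exact hasSum_of_eq ((se.sub (sα1.mul_left 2)).add sα2) (fun n => by ring)
        (by simp only [wedge]; ring)
    rcases n with _ | _ | n
    · simp [euler, shift, seq]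
    · simp [euler, shift, seq]
    · simp only [euler, shift, seq, next]
      have := hn n
      have := hn'' n
      push_cast
      field_simp
      ring
  · refine hasDerivAt_eval_one_sub_tanh
      (r := fun n => 2 * κ * (seq κ A n).e
        - A * (2 * (shift (fun n => (seq κ A n).b) n + shift (fun n => (seq κ A n).c) n)
          - (shift (shift fun n => (seq κ A n).b) n + shift (shift fun n => (seq κ A n).c) n))
        + 2 * (2 * shift (fun n => (seq κ A n).p) n - shift (shift fun n => (seq κ A n).p) n))
      (fun n => (hC n).2.2.2.1) hy ?_ fun n => ?_
    · exact hasSum_of_eq (((se.mul_left (2 * κ)).sub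
        ((((sb1.add sc1).mul_left 2).sub (sb2.add sc2)).mul_left A)).add
        (((sp1.mul_left 2).sub sp2).mul_left 2)) (fun n => by ring)
        (by simp only [wedge]; ring)
    rcases n with _ | _ | n
    · simp [euler, shift, seq]
    · simp [euler, shift, seq]
    · simp only [euler, shift, seq, next]
      have := hn n
      push_cast
      field_simp
      ring
  · refine hasDerivAt_eval_one_sub_tanh
      (r := fun n => κ * (seq κ A n).p - 2 * shift (fun n => (seq κ A n).α) n
        + shift (shift fun n => (seq κ A n).α) n) (fun n => (hC n).2.2.2.2) hy
      ?_ fun n => ?_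
    · exact hasSum_of_eq (((sp.mul_left κ).sub (sα1.mul_left 2)).add sα2) (fun n => by ring)
        (by simp only [wedge]; ring)
    rcases n with _ | _ | n
    · simp [euler, shift, seq]
    · have : 2 + κ ≠ 0 := by positivity
      simp [euler, shift, seq]
      field_simp
      ring
    · simp only [euler, shift, seq, next]
      have := hn' n
      push_cast
      field_simp
      ring

theorem tendsto_wedge {κ A C : ℝ}
    (hC : ∀ n, |(seq κ A n).α| ≤ C * (3 / 4) ^ n ∧ |(seq κ A n).b| ≤ C * (3 / 4) ^ n ∧
      |(seq κ A n).c| ≤ C * (3 / 4) ^ n ∧ |(seq κ A n).e| ≤ C * (3 / 4) ^ n ∧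
        |(seq κ A n).p| ≤ C * (3 / 4) ^ n)
    :
    Tendsto (fun y => (wedge κ A y).α) atTop (𝓝 (1 + κ)) ∧
    Tendsto (fun y => (wedge κ A y).b) atTop (𝓝 0) ∧
    Tendsto (fun y => (wedge κ A y).c) atTop (𝓝 0) ∧
    Tendsto (fun y => (wedge κ A y).e) atTop (𝓝 0) ∧
    Tendsto (fun y => (wedge κ A y).p) atTop (𝓝 0) :=
  ⟨tendsto_eval_one_sub_tanh fun n => (hC n).1, tendsto_eval_one_sub_tanh fun n => (hC n).2.1,
    tendsto_eval_one_sub_tanh fun n => (hC n).2.2.1,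
    tendsto_eval_one_sub_tanh fun n => (hC n).2.2.2.1,
    tendsto_eval_one_sub_tanh fun n => (hC n).2.2.2.2⟩

end JostCoeff

/-- A solution of the rescaled threshold system, written as a first order system. -/
structure ThresholdSolution (κ a : ℝ) (u u₁ v v₁ : ℝ → ℝ) : Prop where
  du : ∀ y, HasDerivAt u (u₁ y) y
  du₁ : ∀ y, HasDerivAt u₁ (-(1 - Real.tanh y ^ 2) * (a ^ 2 * u y + a * v y)) y
  dv : ∀ y, HasDerivAt v (v₁ y) y
  dv₁ : ∀ y, HasDerivAt v₁
    (κ ^ 2 * v y + -(1 - Real.tanh y ^ 2) * (a * u y + a ^ 2 * v y)) y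

theorem nonpos_of_deriv_le {E E' : ℝ → ℝ} {K : ℝ} (hE : ∀ y, HasDerivAt E (E' y) y)
    (hK : ∀ y, E' y ≤ K * E y) (h0 : E 0 = 0) {y : ℝ} (hy : 0 ≤ y) : E y ≤ 0 := by
  have mono : MonotoneOn (fun y => -(E y) * Real.exp (-K * y)) (Set.Ici 0) :=
    monotoneOn_Ici_of_hasDerivAt
      (fun y _ => ((hE y).neg).mul ((hasDerivAt_id' y).const_mul (-K)).exp)
      fun y _ => by
        have := mul_nonneg (sub_nonneg.2 (hK y)) (Real.exp_pos (-K * y)).le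
        rw [Pi.neg_apply]
        linear_combination this
  have := mono (Set.mem_Ici.2 le_rfl) (Set.mem_Ici.2 hy) hy
  simp only [h0, neg_zero, zero_mul] at this
  have h := Real.exp_pos (-K * y)
  by_contra! hpos
  nlinarith

namespace ThresholdSolution

variable {κ a M : ℝ} {u u₁ v v₁ : ℝ → ℝ}

theorem reflect (h : ThresholdSolution κ a u u₁ v v₁) :
    ThresholdSolution κ a (fun y => u (-y)) (fun y => -u₁ (-y)) (fun y => v (-y))
      (fun y => -v₁ (-y)) where
  du y := ((h.du (-y)).comp y (hasDerivAt_neg y)).congr_deriv (by ring)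
  du₁ y := ((h.du₁ (-y)).comp y (hasDerivAt_neg y)).neg.congr_deriv (by
    rw [Real.tanh_neg]; ring)
  dv y := ((h.dv (-y)).comp y (hasDerivAt_neg y)).congr_deriv (by ring)
  dv₁ y := ((h.dv₁ (-y)).comp y (hasDerivAt_neg y)).neg.congr_deriv (by
    rw [Real.tanh_neg]; ring)

theorem neg (h : ThresholdSolution κ a u u₁ v v₁) :
    ThresholdSolution κ a (fun y => -u y) (fun y => -u₁ y) (fun y => -v y) (fun y => -v₁ y) where
  du y := (h.du y).neg
  du₁ y := (h.du₁ y).neg.congr_deriv (by ring)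
  dv y := (h.dv y).neg
  dv₁ y := (h.dv₁ y).neg.congr_deriv (by ring)

theorem eq_zero_of_nonneg (h : ThresholdSolution κ a u u₁ v v₁) (hu : u 0 = 0) (hu₁ : u₁ 0 = 0)
    (hv : v 0 = 0) (hv₁ : v₁ 0 = 0) {y : ℝ} (hy : 0 ≤ y) : u y = 0 ∧ v y = 0 := by
  have dE (y : ℝ) := ((((h.du y).pow 2).add ((h.du₁ y).pow 2)).add ((h.dv y).pow 2)).add
    ((h.dv₁ y).pow 2)
  have key := nonpos_of_deriv_le (K := 1 + a ^ 2 + |a| + (1 + κ ^ 2) + |a| + a ^ 2) dE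
    (fun y => ?_) (by simp [hu, hu₁, hv, hv₁]) hy
  · simp only [Pi.add_apply, Pi.pow_apply] at key
    have s₁ := sq_nonneg (u y)
    have s₂ := sq_nonneg (u₁ y)
    have s₃ := sq_nonneg (v y)
    have s₄ := sq_nonneg (v₁ y)
    exact ⟨pow_eq_zero_iff two_ne_zero |>.1 (by linarith),
      pow_eq_zero_iff two_ne_zero |>.1 (by linarith)⟩
  · simp only [Pi.add_apply, Pi.pow_apply, Nat.cast_ofNat, Nat.reduceSub, pow_one]
    have q0 := Real.one_sub_tanh_sq_nonneg y
    have q1 : 1 - Real.tanh y ^ 2 ≤ 1 := by linarith [sq_nonneg (Real.tanh y)]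
    generalize 1 - Real.tanh y ^ 2 = q at q0 q1
    generalize u y = x₁
    generalize u₁ y = x₂
    generalize v y = x₃
    generalize v₁ y = x₄
    have s₁ := sq_nonneg x₁
    have s₂ := sq_nonneg x₂
    have s₃ := sq_nonneg x₃
    have s₄ := sq_nonneg x₄
    generalize hE : x₁ ^ 2 + x₂ ^ 2 + x₃ ^ 2 + x₄ ^ 2 = E
    have prod (c B x z : ℝ) (hB : |c| ≤ B) (hxz : x ^ 2 + z ^ 2 ≤ E) : c * (2 * x * z) ≤ B * E := by
      refine (le_abs_self _).trans ?_
      rw [abs_mul]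
      have : |2 * x * z| ≤ E := by
        rw [abs_le]
        constructor <;> linarith [sq_nonneg (x + z), sq_nonneg (x - z), add_sq x z, sub_sq x z]
      exact mul_le_mul hB this (abs_nonneg _) ((abs_nonneg _).trans hB)
    have hq (c B : ℝ) (hc : |c| ≤ B) : |-q * c| ≤ B := by
      rw [abs_mul, abs_neg, abs_of_nonneg q0]
      nlinarith [abs_nonneg c]
    have ha2 : |a ^ 2| ≤ a ^ 2 := (abs_of_nonneg (sq_nonneg a)).le
    have p1 := prod 1 1 x₁ x₂ (by simp) (by linarith)
    have p2 := prod (-q * a ^ 2) (a ^ 2) x₂ x₁ (hq _ _ ha2) (by linarith)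
    have p3 := prod (-q * a) |a| x₂ x₃ (hq _ _ le_rfl) (by linarith)
    have p4 := prod (1 + κ ^ 2) (1 + κ ^ 2) x₃ x₄ (abs_of_nonneg (by positivity)).le (by linarith)
    have p5 := prod (-q * a) |a| x₄ x₁ (hq _ _ le_rfl) (by linarith)
    have p6 := prod (-q * a ^ 2) (a ^ 2) x₄ x₃ (hq _ _ ha2) (by linarith)
    linear_combination p1 + p2 + p3 + p4 + p5 + p6

theorem eq_zero (h : ThresholdSolution κ a u u₁ v v₁) (hu : u 0 = 0) (hu₁ : u₁ 0 = 0)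
    (hv : v 0 = 0) (hv₁ : v₁ 0 = 0) (y : ℝ) : u y = 0 ∧ v y = 0 := by
  rcases le_total 0 y with hy | hy
  · exact h.eq_zero_of_nonneg hu hu₁ hv hv₁ hy
  · simpa using h.reflect.eq_zero_of_nonneg (y := -y) (by simpa) (by simpa) (by simpa) (by simpa)
      (by simpa)

theorem source_le (c d : ℝ) (hu : ∀ y, |u y| ≤ M) (hv : ∀ y, |v y| ≤ M) (y : ℝ) :
    |-(1 - Real.tanh y ^ 2) * (c * u y + d * v y)|
      ≤ (|c| * M + |d| * M) * (1 - Real.tanh y ^ 2) := by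
  have q0 := Real.one_sub_tanh_sq_nonneg y
  rw [abs_mul, abs_neg, abs_of_nonneg q0, mul_comm]
  refine mul_le_mul_of_nonneg_right ((abs_add_le _ _).trans ?_) q0
  rw [abs_mul, abs_mul]
  gcongr
  · exact hu y
  · exact hv y

theorem tendsto_deriv (h : ThresholdSolution κ a u u₁ v v₁) (hu : ∀ y, |u y| ≤ M)
    (hv : ∀ y, |v y| ≤ M) : Tendsto u₁ atTop (𝓝 0) := by
  have up := deriv_le_of_bounded h.du h.du₁ hu (source_le _ _ hu hv)
  have down := deriv_le_of_bounded h.neg.du h.neg.du₁ (M := M) (by simpa)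
    (source_le _ _ (M := M) (by simpa) (by simpa))
  have t := Real.tendsto_one_sub_tanh.const_mul (|a ^ 2| * M + |a| * M)
  rw [mul_zero] at t
  exact squeeze_zero_norm (fun y => abs_le.2 ⟨by linarith [down y], up y⟩) t

theorem tendsto_growing (h : ThresholdSolution κ a u u₁ v v₁) (hκ : 0 < κ) (hu : ∀ y, |u y| ≤ M)
    (hv : ∀ y, |v y| ≤ M) : Tendsto (fun y => v₁ y + κ * v y) atTop (𝓝 0) := by
  have up := growing_mode_le_of_bounded hκ h.dv h.dv₁ hv (source_le _ _ hu hv)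
  have down := growing_mode_le_of_bounded hκ h.neg.dv h.neg.dv₁ (M := M) (by simpa)
    (source_le _ _ (M := M) (by simpa) (by simpa))
  have t := Real.tendsto_one_sub_tanh.const_mul (|a| * M + |a ^ 2| * M)
  rw [mul_zero] at t
  exact squeeze_zero_norm (fun y => abs_le.2 ⟨by linarith [down y], up y⟩) t

open JostCoeff

/-- A bounded solution is annihilated by the wedge product of the bounded Jost solutions. -/
theorem wedge_eq_zero (h : ThresholdSolution κ a u u₁ v v₁) (hκ : 0 < κ) (hu : ∀ y, |u y| ≤ M)
    (hv : ∀ y, |v y| ≤ M) {C : ℝ}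
    (hC : ∀ n, |(seq κ (a ^ 2) n).α| ≤ C * (3 / 4) ^ n ∧ |(seq κ (a ^ 2) n).b| ≤ C * (3 / 4) ^ n ∧
      |(seq κ (a ^ 2) n).c| ≤ C * (3 / 4) ^ n ∧ |(seq κ (a ^ 2) n).e| ≤ C * (3 / 4) ^ n ∧
        |(seq κ (a ^ 2) n).p| ≤ C * (3 / 4) ^ n)
    {W : JostCoeff ℝ} (hW : W = wedge κ (a ^ 2) 0) :
    u 0 * (a * W.p) + v 0 * (a ^ 2 * W.b - κ * W.α) - v₁ 0 * W.α = 0 ∧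
    u₁ 0 * (a * W.p) + v 0 * (a ^ 2 * (W.e - κ * W.c)) - v₁ 0 * (a ^ 2 * W.c) = 0 ∧
    -(u 0 * (a ^ 2 * W.c)) + u₁ 0 * W.α - v 0 * (a * W.p) = 0 ∧
    -(u 0 * (a ^ 2 * (W.e - κ * W.c))) + u₁ 0 * (a ^ 2 * W.b - κ * W.α) - v₁ 0 * (a * W.p)
      = 0 := by
  subst hW
  obtain ⟨tα, tb, tc, te, tp⟩ := tendsto_wedge hC
  have tu := h.tendsto_deriv hu hv
  have tz := h.tendsto_growing hκ hu hv
  have bdd (f g : ℝ → ℝ) (hf : ∀ y, |f y| ≤ M) (hg : Tendsto g atTop (𝓝 0)) :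
      Tendsto (fun y => f y * g y) atTop (𝓝 0) :=
    isBoundedUnder_le_mul_tendsto_zero (isBoundedUnder_of ⟨M, hf⟩) hg
  have z0 (f g : ℝ → ℝ) (s : ℝ) (hf : Tendsto f atTop (𝓝 0)) (hg : Tendsto g atTop (𝓝 s)) :
      Tendsto (fun y => f y * g y) atTop (𝓝 0) := by simpa using hf.mul hg
  refine eq_zero_of_tendsto_zero (a := a) hκ
    (h₁ := fun y => u y * (a * (wedge κ (a ^ 2) y).p)
      + v y * (a ^ 2 * (wedge κ (a ^ 2) y).b - κ * (wedge κ (a ^ 2) y).α)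
      - v₁ y * (wedge κ (a ^ 2) y).α)
    (h₂ := fun y => u₁ y * (a * (wedge κ (a ^ 2) y).p)
      + v y * (a ^ 2 * ((wedge κ (a ^ 2) y).e - κ * (wedge κ (a ^ 2) y).c))
      - v₁ y * (a ^ 2 * (wedge κ (a ^ 2) y).c))
    (h₃ := fun y => -(u y * (a ^ 2 * (wedge κ (a ^ 2) y).c)) + u₁ y * (wedge κ (a ^ 2) y).α
      - v y * (a * (wedge κ (a ^ 2) y).p))
    (h₄ := fun y => -(u y * (a ^ 2 * ((wedge κ (a ^ 2) y).e - κ * (wedge κ (a ^ 2) y).c)))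
      + u₁ y * (a ^ 2 * (wedge κ (a ^ 2) y).b - κ * (wedge κ (a ^ 2) y).α)
      - v₁ y * (a * (wedge κ (a ^ 2) y).p))
    (fun y hy => ?_) (fun y hy => ?_) (fun y hy => ?_) (fun y hy => ?_) ?_ ?_ ?_ ?_
  · obtain ⟨dα, db, dc, de, dp⟩ := hasDerivAt_wedge hC hκ hy
    refine ((((h.du y).mul (dp.const_mul a)).add
      ((h.dv y).mul ((db.const_mul (a ^ 2)).sub (dα.const_mul κ)))).sub
      ((h.dv₁ y).mul dα)).congr_deriv ?_
    simp only [Pi.sub_apply]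
    ring
  · obtain ⟨dα, db, dc, de, dp⟩ := hasDerivAt_wedge hC hκ hy
    refine ((((h.du₁ y).mul (dp.const_mul a)).add
      ((h.dv y).mul ((de.sub (dc.const_mul κ)).const_mul (a ^ 2)))).sub
      ((h.dv₁ y).mul (dc.const_mul (a ^ 2)))).congr_deriv ?_
    simp only [Pi.sub_apply]
    ring
  · obtain ⟨dα, db, dc, de, dp⟩ := hasDerivAt_wedge hC hκ hy
    refine (((((h.du y).mul (dc.const_mul (a ^ 2))).neg).add ((h.du₁ y).mul dα)).sub
      ((h.dv y).mul (dp.const_mul a))).congr_deriv ?_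
    ring
  · obtain ⟨dα, db, dc, de, dp⟩ := hasDerivAt_wedge hC hκ hy
    refine (((((h.du y).mul ((de.sub (dc.const_mul κ)).const_mul (a ^ 2))).neg).add
      ((h.du₁ y).mul ((db.const_mul (a ^ 2)).sub (dα.const_mul κ)))).sub
      ((h.dv₁ y).mul (dp.const_mul a))).congr_deriv ?_
    simp only [Pi.sub_apply]
    ring
  · have := (((bdd u _ hu tp).const_mul a).add ((bdd v _ hv tb).const_mul (a ^ 2))).sub
      (z0 _ _ _ tz tα)
    simp only [mul_zero, add_zero, sub_zero] at this
    exact this.congr fun y => by ring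
  · have := (((z0 _ _ _ tu tp).const_mul a).add ((bdd v _ hv te).const_mul (a ^ 2))).sub
      ((z0 _ _ _ tz tc).const_mul (a ^ 2))
    simp only [mul_zero, add_zero, sub_zero] at this
    exact this.congr fun y => by ring
  · have := (((bdd u _ hu tc).const_mul (-a ^ 2)).add (z0 _ _ _ tu tα)).sub
      ((bdd v _ hv tp).const_mul a)
    simp only [mul_zero, add_zero, sub_zero] at this
    exact this.congr fun y => by ring
  · have := ((((bdd u _ hu te).const_mul (-a ^ 2)).add
      ((bdd u _ hu tc).const_mul (a ^ 2 * κ))).add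
      (((z0 _ _ _ tu tb).const_mul (a ^ 2)).sub ((z0 _ _ _ tu tα).const_mul κ))).sub
      (((z0 _ _ _ tz tp).const_mul a).sub ((bdd v _ hv tp).const_mul (a * κ)))
    simp only [mul_zero, add_zero, sub_zero] at this
    exact this.congr fun y => by ring

theorem eq_zero_of_wedge_ne_zero (h : ThresholdSolution κ a u u₁ v v₁) (hκ : 0 < κ) (ha : a ≠ 0)
    (hu : ∀ y, |u y| ≤ M) (hv : ∀ y, |v y| ≤ M) {C : ℝ}
    (hC : ∀ n, |(seq κ (a ^ 2) n).α| ≤ C * (3 / 4) ^ n ∧ |(seq κ (a ^ 2) n).b| ≤ C * (3 / 4) ^ n ∧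
      |(seq κ (a ^ 2) n).c| ≤ C * (3 / 4) ^ n ∧ |(seq κ (a ^ 2) n).e| ≤ C * (3 / 4) ^ n ∧
        |(seq κ (a ^ 2) n).p| ≤ C * (3 / 4) ^ n)
    (hodd : (wedge κ (a ^ 2) 0).α ≠ 0)
    (heven : (wedge κ (a ^ 2) 0).e - κ * (wedge κ (a ^ 2) 0).c ≠ 0) (y : ℝ) :
    u y = 0 ∧ v y = 0 := by
  obtain ⟨h1, h2, h3, h4⟩ := h.wedge_eq_zero hκ hu hv hC rfl
  obtain ⟨r1, r2, r3, r4⟩ :=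
    h.reflect.wedge_eq_zero hκ (fun y => hu (-y)) (fun y => hv (-y)) hC rfl
  simp only [neg_zero] at r1 r2 r3 r4
  have ha2 := mul_ne_zero (pow_ne_zero 2 ha) heven
  refine h.eq_zero ?_ ?_ ?_ ?_ y
  · exact (mul_eq_zero.1 (show u 0 * _ = 0 by linear_combination -(h4 + r4) / 2)).resolve_right ha2
  · exact (mul_eq_zero.1 (show u₁ 0 * _ = 0 by linear_combination (h3 - r3) / 2)).resolve_right hodd
  · exact (mul_eq_zero.1 (show v 0 * _ = 0 by linear_combination (h2 + r2) / 2)).resolve_right ha2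
  · exact (mul_eq_zero.1 (show v₁ 0 * _ = 0 by linear_combination -(h1 - r1) / 2)).resolve_right
      hodd

end ThresholdSolution

namespace JostCoeff

theorem seq_uncoupled_α (κ : ℝ) (n : ℕ) : (seq κ 0 (n + 1)).α = 0 := by
  induction n with
  | zero => simp [seq]
  | succ n ih => simp [seq, next, ih]

theorem seq_uncoupled_rec {κ : ℝ} (hκ : -(3 / 2) < κ) (n : ℕ) :
    (2 * (n + 2) + κ) * (seq κ 0 (n + 2)).p
      = (n + 1) * (seq κ 0 (n + 1)).p - (seq κ 0 n).α ∧
    (2 * (n + 2) + 2 * κ) * (seq κ 0 (n + 2)).e = (n + 1) * (seq κ 0 (n + 1)).e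
      - 2 * (2 * (seq κ 0 (n + 1)).p - (seq κ 0 n).p) ∧
    2 * (n + 2) * (seq κ 0 (n + 2)).c
      = (n + 1) * (seq κ 0 (n + 1)).c - (seq κ 0 (n + 2)).e - (seq κ 0 n).α := by
  have hn := n.cast_nonneg (α := ℝ)
  have h1 : 2 * ((n : ℝ) + 2) + κ ≠ 0 := by linarith
  have h2 : 2 * ((n : ℝ) + 2) + 2 * κ ≠ 0 := by linarith
  have h3 : 2 * ((n : ℝ) + 2) ≠ 0 := by linarith
  have ep := (eq_div_iff h1).1 (show (seq κ 0 (n + 2)).p = _ from rfl)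
  have ee := (eq_div_iff h2).1 (show (seq κ 0 (n + 2)).e = _ from rfl)
  have ec := (eq_div_iff h3).1 (show (seq κ 0 (n + 2)).c =
    ((n + 2 - 1) * (seq κ 0 (n + 1)).c - (seq κ 0 (n + 2)).e
      + (2 * (seq κ 0 (n + 1)).α - (seq κ 0 n).α)) / _ from rfl)
  rw [seq_uncoupled_α] at ep ec
  exact ⟨by linear_combination ep, by linear_combination ee, by linear_combination ec⟩

theorem neg_three_halves_lt_neg_sqrt_two : -(3 / 2) < -√2 := by
  have : √2 < 3 / 2 := (Real.sqrt_lt' (by norm_num)).2 (by norm_num)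
  linarith

theorem seq_uncoupled_p_one : (seq (-√2) 0 1).p = -√2 := by
  have := neg_three_halves_lt_neg_sqrt_two
  have : 2 + -√2 ≠ 0 := by linarith
  have hk2 : √2 ^ 2 = (2 : ℝ) := Real.sq_sqrt zero_le_two
  simp only [seq]
  rw [div_eq_iff this]
  linear_combination -hk2

theorem seq_uncoupled_e_two : (seq (-√2) 0 2).e = 2 + 2 * √2 := by
  have h := neg_three_halves_lt_neg_sqrt_two
  have hk2 : √2 ^ 2 = (2 : ℝ) := Real.sq_sqrt zero_le_two
  obtain ⟨-, r, -⟩ := seq_uncoupled_rec h 0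
  rw [zero_add, zero_add, seq_uncoupled_p_one] at r
  simp only [seq, Nat.cast_zero] at r ⊢
  have h4 : 4 - 2 * √2 ≠ 0 := by linarith
  apply mul_left_cancel₀ h4
  linear_combination r + 4 * hk2

theorem seq_uncoupled_c_two : 4 * (seq (-√2) 0 2).c = -(seq (-√2) 0 2).e := by
  obtain ⟨-, -, r⟩ := seq_uncoupled_rec neg_three_halves_lt_neg_sqrt_two 0
  rw [zero_add, zero_add] at r
  have h0 : (seq (-√2) 0 0).α = 1 + -√2 := rfl
  have h1 : (seq (-√2) 0 1).c = 1 + -√2 := rfl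
  rw [h0, h1, Nat.cast_zero] at r
  linear_combination r

theorem seq_uncoupled_sign (n : ℕ) :
    (seq (-√2) 0 (n + 3)).p < 0 ∧ -(seq (-√2) 0 (n + 3)).p ≤ (seq (-√2) 0 (n + 3)).e ∧
      0 ≤ (seq (-√2) 0 (n + 3)).e - (-√2) * (seq (-√2) 0 (n + 3)).c := by
  have hk2 : √2 ^ 2 = (2 : ℝ) := Real.sq_sqrt zero_le_two
  have hk0 : 1.414 < √2 := Real.lt_sqrt_of_sq_lt (by norm_num)
  have hk1 : √2 < 1.415 := (Real.sqrt_lt' (by norm_num)).2 (by norm_num)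
  have recs (n : ℕ) := seq_uncoupled_rec neg_three_halves_lt_neg_sqrt_two n
  induction n with
  | zero =>
    obtain ⟨r2, -, -⟩ := recs 0
    obtain ⟨r3, re, rc⟩ := recs 1
    have h0 : (seq (-√2) 0 0).α = 1 + -√2 := rfl
    have h1 : (seq (-√2) 0 1).α = 0 := seq_uncoupled_α _ 0
    have ec := seq_uncoupled_c_two
    simp only [zero_add, Nat.cast_zero, Nat.cast_one, Nat.reduceAdd, h0, h1,
      seq_uncoupled_p_one, seq_uncoupled_e_two] at *
    generalize (seq (-√2) 0 2).p = p2 at *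
    generalize (seq (-√2) 0 3).p = p3 at *
    generalize (seq (-√2) 0 3).e = e3 at *
    generalize (seq (-√2) 0 3).c = c3 at *
    generalize (seq (-√2) 0 2).c = c2 at *
    have hp2 : p2 < 0 := by nlinarith
    have hp2' : -1 < p2 := by nlinarith
    have hp3 : p3 < 0 := by nlinarith
    have hp3' : -1 < p3 := by nlinarith
    have he3 : 2 < e3 := by nlinarith
    refine ⟨hp3, by linarith, ?_⟩
    have : 6 * (e3 - -√2 * c3) = (6 - √2) * e3 - (2 + √2) := by
      linear_combination √2 * rc + √2 / 2 * ec - hk2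
    nlinarith
  | succ n ih =>
    obtain ⟨r1, -, -⟩ := recs (n + 1)
    obtain ⟨r2, re, rc⟩ := recs (n + 2)
    have h1 : (seq (-√2) 0 (n + 1)).α = 0 := seq_uncoupled_α _ n
    have h2 : (seq (-√2) 0 (n + 2)).α = 0 := seq_uncoupled_α _ (n + 1)
    rw [h1] at r1
    rw [h2] at r2 rc
    have hn := n.cast_nonneg (α := ℝ)
    obtain ⟨i1, i2, i3⟩ := ih
    rw [show n + 1 + 3 = n + 4 by ring]
    simp only [add_assoc, Nat.reduceAdd] at *
    push_cast at *
    generalize (seq (-√2) 0 (n + 2)).p = p2 at *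
    generalize (seq (-√2) 0 (n + 3)).p = p3 at *
    generalize (seq (-√2) 0 (n + 4)).p = p4 at *
    generalize (seq (-√2) 0 (n + 3)).e = e3 at *
    generalize (seq (-√2) 0 (n + 4)).e = e4 at *
    generalize (seq (-√2) 0 (n + 3)).c = c3 at *
    generalize (seq (-√2) 0 (n + 4)).c = c4 at *
    generalize (n : ℝ) = x at *
    generalize √2 = k at *
    have hp4 : p4 < 0 := by nlinarith
    have hd : 0 < (x + 2) * (2 * (x + 4) - k) := mul_pos (by linarith) (by linarith)
    have main : (4 - 2 * k) * (2 * (x + 4) - k) ≤ k * (x + 3) * (x + 2) := by nlinarith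
    have ht : k * p4 ≤ 2 * p2 - 4 * p3 := by
      refine le_of_mul_le_mul_left ?_ hd
      have : (x + 2) * (2 * (x + 4) - k) * (2 * p2 - 4 * p3 - k * p4)
          = (k * (x + 3) * (x + 2) - (4 - 2 * k) * (2 * (x + 4) - k)) * -p3 := by
        linear_combination (-2 * (2 * (x + 4) - k)) * r1 - k * (x + 2) * r2
      have := mul_nonneg (sub_nonneg.2 main) (neg_nonneg.2 i1.le)
      linarith
    have he : -p4 ≤ e4 := by
      have : 0 < 2 * (x + 4) - 2 * k := by linarith
      refine le_of_mul_le_mul_left ?_ this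
      nlinarith
    refine ⟨hp4, he, ?_⟩
    have : 2 * (x + 4) * (e4 - -k * c4)
        = (x + 3) * (e3 - -k * c3) + k * (e4 + p4) + (2 * p2 - 4 * p3 - k * p4) := by
      linear_combination re + k * rc
    have h5 : 0 ≤ 2 * (x + 4) * (e4 - -k * c4) := by
      rw [this]
      have := mul_nonneg (show 0 ≤ x + 3 by linarith) i3
      have := mul_nonneg (show 0 ≤ k by linarith) (show 0 ≤ e4 + p4 by linarith)
      linarith
    exact nonneg_of_mul_nonneg_right h5 (by linarith)

theorem tsum_uncoupled_pos
    (hs : Summable fun n => (seq (-√2) 0 n).e - (-√2) * (seq (-√2) 0 n).c) :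
    0 < ∑' n, ((seq (-√2) 0 n).e - (-√2) * (seq (-√2) 0 n).c) := by
  have hk2 : √2 ^ 2 = (2 : ℝ) := Real.sq_sqrt zero_le_two
  have hk0 : 1 < √2 := Real.lt_sqrt_of_sq_lt (by norm_num)
  rw [← hs.sum_add_tsum_nat_add 3]
  refine add_pos_of_pos_of_nonneg ?_ (tsum_nonneg fun n => (seq_uncoupled_sign n).2.2)
  have ec := seq_uncoupled_c_two
  have h0 : (seq (-√2) 0 0).c = 0 := rfl
  have h0' : (seq (-√2) 0 0).e = 0 := rfl
  have h1 : (seq (-√2) 0 1).c = 1 + -√2 := rfl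
  have h1' : (seq (-√2) 0 1).e = 0 := rfl
  rw [seq_uncoupled_e_two] at ec
  simp only [Finset.sum_range_succ, Finset.sum_range_zero, h0, h0', h1, h1', seq_uncoupled_e_two]
  nlinarith

end JostCoeff

namespace JostCoeff

/-- The function whose zeros are the parameters with an odd threshold resonance. -/
noncomputable def oddJost (κ : ℂ) : ℂ := ∑' n, (seq κ (coupling κ) n).α

/-- The function whose zeros are the parameters with an even threshold resonance. -/
noncomputable def evenJost (κ : ℂ) : ℂ :=
  ∑' n, ((seq κ (coupling κ) n).e - κ * (seq κ (coupling κ) n).c)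

theorem differentiableAt_jost {κ₀ : ℂ} (hκ₀ : κ₀ ∈ domain) :
    DifferentiableAt ℂ oddJost κ₀ ∧ DifferentiableAt ℂ evenJost κ₀ := by
  obtain ⟨r, hr, hrd⟩ := Metric.nhds_basis_closedBall.mem_iff.1 (isOpen_domain.mem_nhds hκ₀)
  have hcpt := isCompact_closedBall κ₀ r
  obtain ⟨C, hC⟩ := exists_boundedBy_geometric hcpt hrd
  obtain ⟨R, hR⟩ := hcpt.exists_bound_of_continuousOn continuousOn_id
  have sub : Metric.ball κ₀ r ⊆ Metric.closedBall κ₀ r := Metric.ball_subset_closedBall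
  have hball := Metric.ball_mem_nhds κ₀ hr
  have sg : Summable fun n : ℕ => (3 / 4 : ℝ) ^ n :=
    summable_geometric_of_lt_one (by norm_num) (by norm_num)
  constructor
  · refine DifferentiableOn.differentiableAt (s := Metric.ball κ₀ r) ?_ hball
    exact Complex.differentiableOn_tsum_of_summable_norm (sg.mul_left C)
      (fun n => (differentiableOn_seq n).1.mono (sub.trans hrd)) Metric.isOpen_ball
      fun n w hw => (hC w (sub hw) n).1
  · refine DifferentiableOn.differentiableAt (s := Metric.ball κ₀ r) ?_ hball
    refine Complex.differentiableOn_tsum_of_summable_norm (u := fun n => (C + R * C) * (3 / 4) ^ n)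
      (sg.mul_left _)
      (fun n => ?_) Metric.isOpen_ball fun n w hw => ?_
    · obtain ⟨-, -, hc, he, -⟩ := differentiableOn_seq n
      exact (he.sub (differentiableOn_id.mul hc)).mono (sub.trans hrd)
    · obtain ⟨-, -, hc, he, -⟩ := hC w (sub hw) n
      have hw' : ‖w‖ ≤ R := hR w (sub hw)
      calc ‖_ - w * _‖ ≤ C * (3 / 4) ^ n + R * (C * (3 / 4) ^ n) := by
            refine (norm_sub_le _ _).trans (add_le_add he ?_)
            rw [norm_mul]
            exact mul_le_mul hw' hc (norm_nonneg _) ((norm_nonneg _).trans hw')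
        _ = _ := by ring

theorem exists_abs_seq_le {κ A : ℝ} {κ' : ℂ} (hd : κ' ∈ domain) (hκ : (κ : ℂ) = κ')
    (hA : (A : ℂ) = coupling κ') :
    ∃ C : ℝ, ∀ n, |(seq κ A n).α| ≤ C * (3 / 4) ^ n ∧ |(seq κ A n).b| ≤ C * (3 / 4) ^ n ∧
      |(seq κ A n).c| ≤ C * (3 / 4) ^ n ∧ |(seq κ A n).e| ≤ C * (3 / 4) ^ n ∧
        |(seq κ A n).p| ≤ C * (3 / 4) ^ n := by
  obtain ⟨C, hC⟩ := exists_boundedBy_geometric (isCompact_singleton (x := κ'))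
    (Set.singleton_subset_iff.2 hd)
  exact ⟨C, fun n => abs_le_of_seq hκ hA (hC κ' rfl n)⟩

theorem jost_ofReal {κ A : ℝ} (hA : (A : ℂ) = coupling κ) :
    oddJost κ = ((∑' n, (seq κ A n).α : ℝ) : ℂ) ∧
    evenJost κ = ((∑' n, ((seq κ A n).e - κ * (seq κ A n).c) : ℝ) : ℂ) := by
  have h (n : ℕ) : seq (κ : ℂ) (coupling κ) n = map Complex.ofRealHom (seq κ A n) := by
    rw [← seq_map, ← hA]; rfl
  constructor
  · rw [Complex.ofReal_tsum, oddJost]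
    exact tsum_congr fun n => by rw [h]; rfl
  · rw [Complex.ofReal_tsum, evenJost]
    exact tsum_congr fun n => by rw [h]; simp [map]

theorem jost_ne_zero_uncoupled : oddJost ((-√2 : ℝ) : ℂ) * evenJost ((-√2 : ℝ) : ℂ) ≠ 0 := by
  have hA : ((0 : ℝ) : ℂ) = coupling ((-√2 : ℝ) : ℂ) := by
    have : ((√2 : ℝ) : ℂ) ≠ 0 := by simp
    simp only [coupling, Complex.ofReal_neg, Complex.ofReal_zero]
    field_simp
    ring
  have hd : ((-√2 : ℝ) : ℂ) ∈ domain := by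
    simpa only [domain, Set.mem_ofPred_eq, Complex.ofReal_re]
      using neg_three_halves_lt_neg_sqrt_two
  obtain ⟨C, hC⟩ := exists_abs_seq_le hd rfl hA
  obtain ⟨ho, he⟩ := jost_ofReal hA
  have sg : Summable fun n : ℕ => C * (3 / 4 : ℝ) ^ n :=
    (summable_geometric_of_lt_one (by norm_num) (by norm_num)).mul_left C
  rw [ho, he]
  refine mul_ne_zero ?_ ?_
  · rw [tsum_eq_single 0 fun n hn => ?_]
    · have : 1 < √2 := Real.lt_sqrt_of_sq_lt (by norm_num)
      exact_mod_cast (show 1 + -√2 ≠ 0 by linarith)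
    · obtain ⟨m, rfl⟩ := Nat.exists_eq_succ_of_ne_zero hn
      exact seq_uncoupled_α _ m
  · have hse := Summable.of_norm_bounded (f := fun n => (seq (-√2) (0 : ℝ) n).e)
      sg fun n => (hC n).2.2.2.1
    have hsc := Summable.of_norm_bounded (f := fun n => (seq (-√2) (0 : ℝ) n).c)
      sg fun n => (hC n).2.2.1
    exact_mod_cast (tsum_uncoupled_pos (hse.sub (hsc.mul_left _))).ne'

theorem eventually_jost_ne_zero {κ₀ : ℂ} (hκ₀ : κ₀ ∈ domain) :
    ∀ᶠ κ in 𝓝[≠] κ₀, oddJost κ * evenJost κ ≠ 0 := by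
  have hd : DifferentiableOn ℂ (fun κ => oddJost κ * evenJost κ) domain := fun κ hκ =>
    ((differentiableAt_jost hκ).1.mul (differentiableAt_jost hκ).2).differentiableWithinAt
  by_contra h
  have hf : ∃ᶠ κ in 𝓝[≠] κ₀, oddJost κ * evenJost κ = 0 := by
    simpa only [Filter.not_eventually, not_not] using h
  refine jost_ne_zero_uncoupled ((hd.analyticOnNhd
    isOpen_domain).eqOn_zero_of_preconnected_of_frequently_eq_zero isPreconnected_domain hκ₀ hf ?_)
  simpa only [domain, Set.mem_ofPred_eq, Complex.ofReal_re] using neg_three_halves_lt_neg_sqrt_two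

end JostCoeff

open JostCoeff

theorem groundState_rpow {p : ℝ} (hp : 1 < p) (x : ℝ) :
    groundState p x ^ (p - 1) = (p + 1) / 2 * (1 - Real.tanh ((p - 1) / 2 * x) ^ 2) := by
  have hp' : p - 1 ≠ 0 := by linarith
  have hc := Real.cosh_pos ((p - 1) * x / 2)
  have h1 : 0 ≤ (p + 1) / 2 := by linarith
  have h2 : 0 ≤ 1 / Real.cosh ((p - 1) * x / 2) := by positivity
  rw [groundState, Real.mul_rpow (by positivity) (by positivity), ← Real.rpow_mul h1,
    ← Real.rpow_mul h2, one_div_mul_cancel hp', Real.rpow_one, div_mul_cancel₀ _ hp',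
    Real.rpow_ofNat, show (p - 1) / 2 * x = (p - 1) * x / 2 by ring, Real.tanh_eq_sinh_div_cosh]
  congr 1
  field_simp
  linear_combination -Real.cosh_sq_sub_sinh_sq ((p - 1) * x / 2)

/-- A real part of a solution of the threshold equation, after rescaling. -/
theorem ThresholdSolution.of_resonant {p : ℝ} (hp : 1 < p) {u v : ℝ → ℂ} (hu : ContDiff ℝ 2 u)
    (hv : ContDiff ℝ 2 v)
    (h : ∀ x : ℝ,
      -(deriv (deriv u) x) + u x
        - ((((p + 1) / 2) * groundState p x ^ (p - 1) : ℝ) : ℂ) * u x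
        - ((((p - 1) / 2) * groundState p x ^ (p - 1) : ℝ) : ℂ) * v x
        = u x ∧
      deriv (deriv v) x - v x
        + ((((p - 1) / 2) * groundState p x ^ (p - 1) : ℝ) : ℂ) * u x
        + ((((p + 1) / 2) * groundState p x ^ (p - 1) : ℝ) : ℂ) * v x
        = v x) (L : ℂ →L[ℝ] ℝ) :
    ThresholdSolution (√2 * (2 / (p - 1))) (1 + 2 / (p - 1))
      (fun y => L (u (2 / (p - 1) * y))) (fun y => 2 / (p - 1) * L (deriv u (2 / (p - 1) * y)))
      (fun y => L (v (2 / (p - 1) * y)))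
      (fun y => 2 / (p - 1) * L (deriv v (2 / (p - 1) * y))) := by
  have hp' : p - 1 ≠ 0 := by linarith
  have first {w : ℝ → ℂ} (hw : ContDiff ℝ 2 w) (x : ℝ) : HasDerivAt w (deriv w x) x :=
    (hw.differentiable (by norm_num) x).hasDerivAt
  have second {w : ℝ → ℂ} (hw : ContDiff ℝ 2 w) (x : ℝ) :
      HasDerivAt (deriv w) (deriv (deriv w) x) x := by
    have : ContDiff ℝ 1 (deriv w) := hw.deriv'
    exact (this.differentiable (by norm_num) x).hasDerivAt
  have comp {w w' : ℝ → ℂ} (hw : ∀ x, HasDerivAt w (w' x) x) (y : ℝ) :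
      HasDerivAt (fun y => L (w (2 / (p - 1) * y))) (2 / (p - 1) * L (w' (2 / (p - 1) * y))) y := by
    have h1 : HasDerivAt (fun y : ℝ => 2 / (p - 1) * y) (2 / (p - 1)) y := by
      simpa using (hasDerivAt_id' y).const_mul (2 / (p - 1))
    have := L.hasFDerivAt.comp_hasDerivAt y ((hw (2 / (p - 1) * y)).scomp y h1)
    exact this.congr_deriv (by rw [map_smul, smul_eq_mul])
  have arg (y : ℝ) : (p - 1) / 2 * (2 / (p - 1) * y) = y := by field_simp
  have hL (r : ℝ) (z : ℂ) : L ((r : ℂ) * z) = r * L z := by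
    rw [← Complex.real_smul, map_smul, smul_eq_mul]
  have h2 : √2 ^ 2 = (2 : ℝ) := Real.sq_sqrt zero_le_two
  refine ⟨comp (first hu), fun y => ?_, comp (first hv), fun y => ?_⟩
  · refine ((comp (second hu) y).const_mul (2 / (p - 1))).congr_deriv ?_
    have e := congrArg L (h (2 / (p - 1) * y)).1
    simp only [map_sub, map_add, map_neg, hL, groundState_rpow hp, arg] at e
    generalize L (deriv (deriv u) (2 / (p - 1) * y)) = U'' at *
    have e' : U'' = -((p + 1) / 2 * ((p + 1) / 2 * (1 - Real.tanh y ^ 2))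
        * L (u (2 / (p - 1) * y))) - (p - 1) / 2 * ((p + 1) / 2 * (1 - Real.tanh y ^ 2))
        * L (v (2 / (p - 1) * y)) := by linear_combination -e
    rw [e']
    field_simp
    ring
  · refine ((comp (second hv) y).const_mul (2 / (p - 1))).congr_deriv ?_
    have e := congrArg L (h (2 / (p - 1) * y)).2
    simp only [map_sub, map_add, hL, groundState_rpow hp, arg] at e
    generalize L (deriv (deriv v) (2 / (p - 1) * y)) = V'' at *
    have e' : V'' = 2 * L (v (2 / (p - 1) * y))
        - (p - 1) / 2 * ((p + 1) / 2 * (1 - Real.tanh y ^ 2)) * L (u (2 / (p - 1) * y))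
        - (p + 1) / 2 * ((p + 1) / 2 * (1 - Real.tanh y ^ 2)) * L (v (2 / (p - 1) * y)) := by
      linear_combination e
    rw [e', mul_pow, h2]
    field_simp
    ring

theorem not_resonant_of_jost_ne_zero {p : ℝ} (hp : 1 < p)
    (hne : oddJost ((√2 * (2 / (p - 1)) : ℝ) : ℂ) * evenJost ((√2 * (2 / (p - 1)) : ℝ) : ℂ) ≠ 0) :
    ¬ Resonant p := by
  rintro ⟨u, v, hnz, ⟨M, hM⟩, hu, hv, h⟩
  have hpos : 0 < 2 / (p - 1) := div_pos two_pos (by linarith)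
  have hκ : 0 < √2 * (2 / (p - 1)) := by positivity
  have hA : (((1 + 2 / (p - 1)) ^ 2 : ℝ) : ℂ) = coupling ((√2 * (2 / (p - 1)) : ℝ) : ℂ) := by
    have : ((√2 : ℝ) : ℂ) ≠ 0 := by simp
    rw [coupling, Complex.ofReal_mul, mul_div_cancel_left₀ _ this]
    push_cast
    rfl
  obtain ⟨C, hC⟩ := exists_abs_seq_le (κ' := ((√2 * (2 / (p - 1)) : ℝ) : ℂ))
    (show -(3 / 2) < Complex.re _ by rw [Complex.ofReal_re]; linarith) rfl hA
  obtain ⟨ho, he⟩ := jost_ofReal hA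
  rw [ho, he, ← Complex.ofReal_mul, Complex.ofReal_ne_zero, mul_ne_zero_iff] at hne
  obtain ⟨hodd, heven⟩ := hne
  have sg : Summable fun n : ℕ => C * (3 / 4 : ℝ) ^ n :=
    (summable_geometric_of_lt_one (by norm_num) (by norm_num)).mul_left C
  have hse := Summable.of_norm_bounded
    (f := fun n => (seq (√2 * (2 / (p - 1))) ((1 + 2 / (p - 1)) ^ 2) n).e)
      sg fun n => (hC n).2.2.2.1
  have hsc := Summable.of_norm_bounded
    (f := fun n => (seq (√2 * (2 / (p - 1))) ((1 + 2 / (p - 1)) ^ 2) n).c)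
      sg fun n => (hC n).2.2.1
  rw [hse.tsum_sub (hsc.mul_left _), tsum_mul_left] at heven
  have key (L : ℂ →L[ℝ] ℝ) (hLn : ∀ z, |L z| ≤ ‖z‖) (x : ℝ) : L (u x) = 0 ∧ L (v x) = 0 := by
    have := (ThresholdSolution.of_resonant hp hu hv h L).eq_zero_of_wedge_ne_zero (M := M) hκ
      (by positivity) (fun y => (hLn _).trans (hM _).1) (fun y => (hLn _).trans (hM _).2) hC
      (by simpa [wedge, GeometricSeries.eval] using hodd)
      (by simpa [wedge, GeometricSeries.eval] using heven) (x / (2 / (p - 1)))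
    simpa only [mul_div_cancel₀ _ hpos.ne'] using this
  refine hnz fun x => ?_
  obtain ⟨hu1, hv1⟩ := key Complex.reCLM Complex.abs_re_le_norm x
  obtain ⟨hu2, hv2⟩ := key Complex.imCLM Complex.abs_im_le_norm x
  exact ⟨Complex.ext hu1 hu2, Complex.ext hv1 hv2⟩

/-- the set of resonant exponents `p` is discrete in `(1, ∞)`: every
`p₀ ∈ (1,∞)` has a punctured neighborhood containing no resonant exponent. -/
theorem stmt_2 :
    ∀ p₀ : ℝ, 1 < p₀ → ∃ ε > (0 : ℝ), ∀ p : ℝ, 1 < p →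
      0 < |p - p₀| → |p - p₀| < ε → ¬ Resonant p := by
  intro p₀ hp₀
  have hpos : 0 < 2 / (p₀ - 1) := div_pos two_pos (by linarith)
  have hcont : ContinuousAt (fun p : ℝ => ((√2 * (2 / (p - 1)) : ℝ) : ℂ)) p₀ := by
    have : p₀ - 1 ≠ 0 := by linarith
    fun_prop (disch := assumption)
  have hev := eventually_nhdsWithin_iff.1 (eventually_jost_ne_zero
    (κ₀ := ((√2 * (2 / (p₀ - 1)) : ℝ) : ℂ))
    (show -(3 / 2) < Complex.re _ by
      rw [Complex.ofReal_re]; linarith [mul_pos (Real.sqrt_pos.2 two_pos) hpos]))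
  obtain ⟨ε, hε, hball⟩ := Metric.eventually_nhds_iff.1 (hcont.eventually hev)
  refine ⟨ε, hε, fun p hp hne hlt => not_resonant_of_jost_ne_zero hp (hball hlt fun heq => ?_)⟩
  rw [Set.mem_singleton_iff, Complex.ofReal_inj] at heq
  have heq' := mul_left_cancel₀ (Real.sqrt_pos.2 two_pos).ne' heq
  have h1 : p - 1 ≠ 0 := by linarith
  have h2 : p₀ - 1 ≠ 0 := by linarith
  rw [div_eq_div_iff h1 h2] at heq'
  have : p - p₀ = 0 := by linarith
  simp [this] at hne
end
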